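/- arXiv:1202.6537 — 2 statements merged into one kernel-verified Lean document; each statement's English description precedes it below -/
import Mathlib

section
/- Let U ⊂ ℝ^q be an open box, V ⊂ ℝ an open interval, and let y : U → V and g : U×V → ℝ be sufficiently smooth with g(x, y(x)) = 0 and g_{0,1}(x, y(x)) = ∂g/∂y(x, y(x)) ≠ 0 for all x ∈ U. Then for any x ∈ U and any nonzero n ∈ ℕ^q, the partial derivative y_n = ∂^{|n|}y/∂x^n satisfies y_n(x)/n! = Σ_p (1/|p|) · ( |p|! / Π_{(s,t)} μ_{p;s,t}! ) · Π_{(s,t) ∈ p} ( −(1/(s! t!)) · g_{s,t}(x, y(x)) / g_{0,1}(x, y(x)) ), where the sum is over all multisets p of nonzero tuples (s,t) ∈ ℕ^q × ℕ such that (0,1) ∉ p and the elements of p sum (with multiplicity) to (n, |p| − 1), |p| is the number of elements of p counted with multiplicity, μ_{p;s,t} is the multiplicity of (s,t) in p, and the product over (s,t) ∈ p counts each element with its multiplicity. -/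
namespace ImplicitDD

/-- The partial derivative of `f : ℝ^q → ℝ` in the `i`-th coordinate direction. -/
noncomputable def pderiv {q : ℕ} (i : Fin q) (f : (Fin q → ℝ) → ℝ) : (Fin q → ℝ) → ℝ :=
  fun v => deriv (fun s => f (Function.update v i s)) (v i)

/-- The iterated partial derivative `∂^{|m|} f / ∂x^m` for a multi-index `m ∈ ℕ^q`. -/
noncomputable def mPDeriv {q : ℕ} (m : Fin q → ℕ) (f : (Fin q → ℝ) → ℝ) :
    (Fin q → ℝ) → ℝ :=
  ((List.ofFn fun j : Fin q => List.replicate (m j) j).flatten).foldr pderiv f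

/-- The mixed partial derivative `g_{s,t} = ∂^{|s|+t} g / ∂x^s ∂y^t` of `g : ℝ^q × ℝ → ℝ`. -/
noncomputable def gPDeriv {q : ℕ} (g : (Fin q → ℝ) → ℝ → ℝ) (S : Fin q → ℕ) (t : ℕ) :
    (Fin q → ℝ) → ℝ → ℝ :=
  fun v w => mPDeriv S (fun v' => deriv^[t] (g v') w) v

end ImplicitDD

namespace ImplicitDD

open Set

section Smooth

variable {q : ℕ} {U : Set (Fin q → ℝ)} {f h : (Fin q → ℝ) → ℝ}

theorem pderiv_eq_fderiv {v : Fin q → ℝ} (i : Fin q) (hf : DifferentiableAt ℝ f v) :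
    pderiv i f v = fderiv ℝ f v (Pi.single i 1) := by
  have hu := hasDerivAt_update v i (v i)
  have hf' : HasFDerivAt f (fderiv ℝ f v) (Function.update v i (v i)) := by
    simpa using hf.hasFDerivAt
  exact (hf'.comp_hasDerivAt (v i) hu).deriv

theorem differentiableAt_of_contDiffOn (hU : IsOpen U) (hf : ContDiffOn ℝ (⊤ : ℕ∞) f U)
    {v : Fin q → ℝ} (hv : v ∈ U) : DifferentiableAt ℝ f v :=
  (hf.contDiffAt (hU.mem_nhds hv)).differentiableAt (by simp)

theorem contDiffOn_pderiv (hU : IsOpen U) (i : Fin q) (hf : ContDiffOn ℝ (⊤ : ℕ∞) f U) :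
    ContDiffOn ℝ (⊤ : ℕ∞) (pderiv i f) U :=
  ((hf.fderiv_of_isOpen hU (by simp)).clm_apply contDiffOn_const).congr fun _ hv =>
    pderiv_eq_fderiv i (differentiableAt_of_contDiffOn hU hf hv)

theorem pderiv_congr (hU : IsOpen U) (i : Fin q) (hfh : EqOn f h U) :
    EqOn (pderiv i f) (pderiv i h) U := by
  intro v hv
  refine Filter.EventuallyEq.deriv_eq ?_
  have hc : ContinuousAt (fun s => Function.update v i s) (v i) := by fun_prop
  filter_upwards [hc.preimage_mem_nhds (by simpa using hU.mem_nhds hv)] with s hs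
  exact hfh hs

theorem pderiv_add (hU : IsOpen U) (i : Fin q) (hf : ContDiffOn ℝ (⊤ : ℕ∞) f U)
    (hh : ContDiffOn ℝ (⊤ : ℕ∞) h U) :
    EqOn (pderiv i (f + h)) (pderiv i f + pderiv i h) U := by
  intro v hv
  have hf' := differentiableAt_of_contDiffOn hU hf hv
  have hh' := differentiableAt_of_contDiffOn hU hh hv
  rw [Pi.add_apply, pderiv_eq_fderiv i hf', pderiv_eq_fderiv i hh',
    pderiv_eq_fderiv i (hf'.add hh'), fderiv_add hf' hh']
  simp

theorem pderiv_mul (hU : IsOpen U) (i : Fin q) (hf : ContDiffOn ℝ (⊤ : ℕ∞) f U)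
    (hh : ContDiffOn ℝ (⊤ : ℕ∞) h U) :
    EqOn (pderiv i (f * h)) (f * pderiv i h + h * pderiv i f) U := by
  intro v hv
  have hf' := differentiableAt_of_contDiffOn hU hf hv
  have hh' := differentiableAt_of_contDiffOn hU hh hv
  rw [Pi.add_apply, Pi.mul_apply, Pi.mul_apply, pderiv_eq_fderiv i hf', pderiv_eq_fderiv i hh',
    pderiv_eq_fderiv i (hf'.mul hh'), fderiv_mul hf' hh']
  simp

theorem pderiv_pderiv_eq_fderiv_fderiv (hU : IsOpen U) (i j : Fin q)
    (hf : ContDiffOn ℝ (⊤ : ℕ∞) f U) {v : Fin q → ℝ} (hv : v ∈ U) :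
    pderiv i (pderiv j f) v
      = fderiv ℝ (fderiv ℝ f) v (Pi.single i 1) (Pi.single j 1) := by
  rw [pderiv_congr hU i
      (fun w hw => pderiv_eq_fderiv j (differentiableAt_of_contDiffOn hU hf hw)) hv]
  have hd : DifferentiableAt ℝ (fderiv ℝ f) v :=
    ((hf.fderiv_of_isOpen (m := (⊤ : ℕ∞)) hU (by simp)).contDiffAt
      (hU.mem_nhds hv)).differentiableAt (by simp)
  rw [pderiv_eq_fderiv i (hd.clm_apply (differentiableAt_const _)),
    fderiv_clm_apply hd (differentiableAt_const _)]
  simp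

theorem pderiv_comm (hU : IsOpen U) (i j : Fin q) (hf : ContDiffOn ℝ (⊤ : ℕ∞) f U) :
    EqOn (pderiv i (pderiv j f)) (pderiv j (pderiv i f)) U := by
  intro v hv
  rw [pderiv_pderiv_eq_fderiv_fderiv hU i j hf hv, pderiv_pderiv_eq_fderiv_fderiv hU j i hf hv]
  refine (hf.contDiffAt (hU.mem_nhds hv)).isSymmSndFDerivAt ?_ _ _
  simp only [minSmoothness_of_isRCLikeNormedField]
  exact WithTop.coe_le_coe.2 le_top

theorem contDiffOn_foldr_pderiv (hU : IsOpen U) (hf : ContDiffOn ℝ (⊤ : ℕ∞) f U)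
    (l : List (Fin q)) : ContDiffOn ℝ (⊤ : ℕ∞) (l.foldr pderiv f) U := by
  induction l with
  | nil => exact hf
  | cons i l ih => exact contDiffOn_pderiv hU i ih

theorem foldr_pderiv_congr (hU : IsOpen U) (hfh : EqOn f h U) (l : List (Fin q)) :
    EqOn (l.foldr pderiv f) (l.foldr pderiv h) U := by
  induction l with
  | nil => exact hfh
  | cons i l ih => exact pderiv_congr hU i ih

theorem foldr_pderiv_perm (hU : IsOpen U) (hf : ContDiffOn ℝ (⊤ : ℕ∞) f U)
    {l l' : List (Fin q)} (hl : l.Perm l') :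
    EqOn (l.foldr pderiv f) (l'.foldr pderiv f) U := by
  induction hl with
  | nil => exact fun _ _ => rfl
  | cons i _ ih => exact pderiv_congr hU i ih
  | swap i j l => exact pderiv_comm hU j i (contDiffOn_foldr_pderiv hU hf l)
  | trans _ _ ih₁ ih₂ => exact ih₁.trans ih₂

theorem count_flatten_ofFn_replicate (m : Fin q → ℕ) (i : Fin q) :
    (List.ofFn fun j : Fin q => List.replicate (m j) j).flatten.count i = m i := by
  rw [List.count_flatten, List.map_ofFn, List.sum_ofFn]
  simp [List.count_replicate]

theorem mPDeriv_congr (hU : IsOpen U) (hfh : EqOn f h U) (m : Fin q → ℕ) :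
    EqOn (mPDeriv m f) (mPDeriv m h) U :=
  foldr_pderiv_congr hU hfh _

theorem mPDeriv_zero : mPDeriv (0 : Fin q → ℕ) f = f := by
  have : (List.ofFn fun j : Fin q => List.replicate ((0 : Fin q → ℕ) j) j).flatten = [] := by
    simp
  rw [mPDeriv, this, List.foldr_nil]

theorem mPDeriv_add_single (hU : IsOpen U) (hf : ContDiffOn ℝ (⊤ : ℕ∞) f U) (m : Fin q → ℕ)
    (i : Fin q) : EqOn (mPDeriv (m + Pi.single i 1) f) (mPDeriv m (pderiv i f)) U := by
  have hp : (List.ofFn fun j : Fin q =>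
      List.replicate ((m + Pi.single i 1 : Fin q → ℕ) j) j).flatten.Perm
      ((List.ofFn fun j : Fin q => List.replicate (m j) j).flatten ++ [i]) := by
    rw [List.perm_iff_count]
    intro j
    rw [List.count_append, count_flatten_ofFn_replicate, count_flatten_ofFn_replicate,
      List.count_singleton]
    rcases eq_or_ne i j with rfl | hij
    · simp
    · simp [hij]
  have := foldr_pderiv_perm hU hf hp
  rwa [List.foldr_append] at this

end Smooth

/-- The Taylor series of `f` at `a`, as a formal power series. -/
noncomputable def jet {q : ℕ} (a : Fin q → ℝ) (f : (Fin q → ℝ) → ℝ) : MvPowerSeries (Fin q) ℝ :=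
  fun n => mPDeriv n f a / ∏ j, ((n j).factorial : ℝ)

section Jet

variable {q : ℕ} {U : Set (Fin q → ℝ)} {f h : (Fin q → ℝ) → ℝ} {a : Fin q → ℝ}

theorem coeff_jet (n : Fin q →₀ ℕ) :
    MvPowerSeries.coeff n (jet a f) = mPDeriv n f a / ∏ j, ((n j).factorial : ℝ) :=
  rfl

theorem coeff_zero_jet : MvPowerSeries.coeff 0 (jet a f) = f a := by
  rw [coeff_jet, Finsupp.coe_zero, mPDeriv_zero]
  simp

theorem jet_congr (hU : IsOpen U) (ha : a ∈ U) (hfh : EqOn f h U) : jet a f = jet a h := by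
  ext n
  rw [coeff_jet, coeff_jet, mPDeriv_congr hU hfh n ha]

theorem pderiv_jet (hU : IsOpen U) (ha : a ∈ U) (hf : ContDiffOn ℝ (⊤ : ℕ∞) f U) (i : Fin q) :
    MvPowerSeries.pderiv ℝ i (jet a f) = jet a (pderiv i f) := by
  ext n
  have hprod : ∏ j, (((n + Finsupp.single i 1 : Fin q →₀ ℕ) j).factorial : ℝ)
      = (n i + 1) * ∏ j, ((n j).factorial : ℝ) := by
    rw [← Finset.mul_prod_erase _ _ (Finset.mem_univ i),
      ← Finset.mul_prod_erase (a := i) _ (fun j => ((n j).factorial : ℝ)) (Finset.mem_univ i),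
      ← mul_assoc]
    congr 1
    · simp [Nat.factorial_succ]
    · refine Finset.prod_congr rfl fun j hj => ?_
      simp [Finsupp.single_eq_of_ne (Finset.ne_of_mem_erase hj)]
  rw [MvPowerSeries.coeff_pderiv, coeff_jet, coeff_jet, hprod, Finsupp.coe_add,
    Finsupp.single_eq_pi_single, mPDeriv_add_single hU hf n i ha]
  have h₁ : (n i + 1 : ℝ) ≠ 0 := by positivity
  have h₂ : ∏ j, ((n j).factorial : ℝ) ≠ 0 :=
    Finset.prod_ne_zero_iff.2 fun j _ => by positivity
  field_simp

/-- Induction on a multi-index, one unit step at a time. -/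
theorem multiIndex_induction {σ : Type*} {P : (σ →₀ ℕ) → Prop} (zero : P 0)
    (add_single : ∀ n i, P n → P (n + Finsupp.single i 1)) (n : σ →₀ ℕ) : P n := by
  induction hd : n.degree generalizing n with
  | zero => rwa [(Finsupp.degree_eq_zero_iff n).1 hd]
  | succ d ih =>
    obtain ⟨i, hi⟩ : ∃ i, n i ≠ 0 := by
      by_contra! hn
      simp [show n = 0 from Finsupp.ext hn] at hd
    have hle : Finsupp.single i 1 ≤ n := by simpa [Nat.one_le_iff_ne_zero] using hi
    have hn := tsub_add_cancel_of_le hle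
    rw [← hn]
    refine add_single _ _ (ih _ ?_)
    have := congrArg Finsupp.degree hn
    rw [map_add, Finsupp.degree_single, hd] at this
    omega

theorem jet_add (hU : IsOpen U) (ha : a ∈ U) (hf : ContDiffOn ℝ (⊤ : ℕ∞) f U)
    (hh : ContDiffOn ℝ (⊤ : ℕ∞) h U) : jet a (f + h) = jet a f + jet a h := by
  ext n
  induction n using multiIndex_induction generalizing f h with
  | zero => simp [-MvPowerSeries.coeff_zero_eq_constantCoeff, coeff_zero_jet]
  | add_single n i ih =>
    have hi : (n i + 1 : ℝ) ≠ 0 := by positivity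
    apply mul_right_cancel₀ hi
    rw [← MvPowerSeries.coeff_pderiv, ← MvPowerSeries.coeff_pderiv, map_add,
      pderiv_jet (f := f + h) hU ha (hf.add hh), pderiv_jet hU ha hf, pderiv_jet hU ha hh,
      jet_congr hU ha (pderiv_add hU i hf hh),
      ih (contDiffOn_pderiv hU i hf) (contDiffOn_pderiv hU i hh)]

theorem jet_sub (hU : IsOpen U) (ha : a ∈ U) (hf : ContDiffOn ℝ (⊤ : ℕ∞) f U)
    (hh : ContDiffOn ℝ (⊤ : ℕ∞) h U) : jet a (f - h) = jet a f - jet a h := by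
  rw [eq_sub_iff_add_eq, ← jet_add (f := f - h) hU ha (hf.sub hh) hh, sub_add_cancel]

theorem jet_neg (hU : IsOpen U) (ha : a ∈ U) (hf : ContDiffOn ℝ (⊤ : ℕ∞) f U) :
    jet a (-f) = -jet a f := by
  have h0 : jet a (f - f) = 0 := by rw [jet_sub hU ha hf hf, sub_self]
  rw [← zero_sub f, ← sub_self f, jet_sub (f := f - f) hU ha (hf.sub hf) hf, h0, zero_sub]

theorem jet_mul (hU : IsOpen U) (ha : a ∈ U) (hf : ContDiffOn ℝ (⊤ : ℕ∞) f U)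
    (hh : ContDiffOn ℝ (⊤ : ℕ∞) h U) : jet a (f * h) = jet a f * jet a h := by
  ext n
  induction n using multiIndex_induction generalizing f h with
  | zero =>
    simp [-MvPowerSeries.coeff_zero_eq_constantCoeff, coeff_zero_jet, MvPowerSeries.coeff_mul]
  | add_single n i ih =>
    have hi : (n i + 1 : ℝ) ≠ 0 := by positivity
    have hfi := contDiffOn_pderiv hU i hf
    have hhi := contDiffOn_pderiv hU i hh
    apply mul_right_cancel₀ hi
    rw [← MvPowerSeries.coeff_pderiv, ← MvPowerSeries.coeff_pderiv, Derivation.leibniz,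
      pderiv_jet (f := f * h) hU ha (hf.mul hh), pderiv_jet hU ha hf, pderiv_jet hU ha hh,
      jet_congr hU ha (pderiv_mul hU i hf hh),
      jet_add (f := f * pderiv i h) (h := h * pderiv i f) hU ha
        (hf.mul hhi) (hh.mul hfi), map_add, map_add, ih hf hhi, ih hh hfi, smul_eq_mul, smul_eq_mul]

end Jet
end ImplicitDD

namespace ImplicitDD

section Formal

open MvPowerSeries (coeff coeff_pderiv)

variable {σ : Type*} {Φ : MvPowerSeries σ ℝ}

theorem formal_pderiv_comm (i j : σ) (Φ : MvPowerSeries σ ℝ) :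
    MvPowerSeries.pderiv ℝ i (MvPowerSeries.pderiv ℝ j Φ)
      = MvPowerSeries.pderiv ℝ j (MvPowerSeries.pderiv ℝ i Φ) := by
  classical
  ext n
  simp only [coeff_pderiv]
  rcases eq_or_ne i j with rfl | hij
  · rfl
  · rw [add_right_comm]
    simp [Finsupp.single_eq_of_ne hij, Finsupp.single_eq_of_ne hij.symm]
    ring

/-- If all monomials of `Φ` have weight at least `2`, then those of `K * Φ ^ m` have weight at
least `2 * m`. -/
theorem coeff_mul_pow_eq_zero {w : (σ →₀ ℕ) →+ ℕ} (hΦ : ∀ d, w d < 2 → coeff d Φ = 0)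
    (K : MvPowerSeries σ ℝ) {m : ℕ} {d : σ →₀ ℕ} (hd : w d < 2 * m) :
    coeff d (K * Φ ^ m) = 0 := by
  classical
  induction m generalizing d with
  | zero => omega
  | succ m ih =>
    rw [pow_succ, ← mul_assoc, MvPowerSeries.coeff_mul]
    refine Finset.sum_eq_zero fun p hp => ?_
    rw [Finset.HasAntidiagonal.mem_antidiagonal] at hp
    have hw : w p.1 + w p.2 = w d := by rw [← map_add, hp]
    by_cases h : w p.2 < 2
    · rw [hΦ _ h, mul_zero]
    · rw [ih (by omega), zero_mul]

/-- The telescoping identity that propagates Lagrange inversion along a derivative in `i`. -/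
theorem sum_coeff_add_single {i z : σ} (hiz : i ≠ z) {K K' : MvPowerSeries σ ℝ}
    (hK : K' * (1 - MvPowerSeries.pderiv ℝ z Φ)
      = MvPowerSeries.pderiv ℝ i K * (1 - MvPowerSeries.pderiv ℝ z Φ)
        + MvPowerSeries.pderiv ℝ z K * MvPowerSeries.pderiv ℝ i Φ)
    {n : σ →₀ ℕ} (hn : n z = 0) {M : ℕ}
    (hM : coeff (n + Finsupp.single z M) (K * MvPowerSeries.pderiv ℝ i Φ * Φ ^ (M - 1)) = 0) :
    (∑ m ∈ Finset.range M, coeff (n + Finsupp.single i 1 + Finsupp.single z m)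
        (K * Φ ^ m * (1 - MvPowerSeries.pderiv ℝ z Φ))) * ((n i : ℝ) + 1)
      = ∑ m ∈ Finset.range M, coeff (n + Finsupp.single z m)
        (K' * Φ ^ m * (1 - MvPowerSeries.pderiv ℝ z Φ)) := by
  classical
  set T : ℕ → ℝ := fun m =>
    m * coeff (n + Finsupp.single z m) (K * MvPowerSeries.pderiv ℝ i Φ * Φ ^ (m - 1)) with hT
  have hstep : ∀ m, coeff (n + Finsupp.single i 1 + Finsupp.single z m)
        (K * Φ ^ m * (1 - MvPowerSeries.pderiv ℝ z Φ)) * ((n i : ℝ) + 1)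
      - coeff (n + Finsupp.single z m) (K' * Φ ^ m * (1 - MvPowerSeries.pderiv ℝ z Φ))
      = T m - T (m + 1) := by
    intro m
    have h₁ : coeff (n + Finsupp.single i 1 + Finsupp.single z m)
        (K * Φ ^ m * (1 - MvPowerSeries.pderiv ℝ z Φ)) * ((n i : ℝ) + 1)
        = coeff (n + Finsupp.single z m) (MvPowerSeries.pderiv ℝ i
          (K * Φ ^ m * (1 - MvPowerSeries.pderiv ℝ z Φ))) := by
      rw [coeff_pderiv, add_right_comm]
      simp [Finsupp.single_eq_of_ne hiz]
    have h₂ : T (m + 1) = coeff (n + Finsupp.single z m) (MvPowerSeries.pderiv ℝ z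
        (K * MvPowerSeries.pderiv ℝ i Φ * Φ ^ m)) := by
      rw [coeff_pderiv, hT, add_assoc, ← Finsupp.single_add]
      simp [hn, mul_comm]
    have h₃ : T m = coeff (n + Finsupp.single z m)
        ((m : MvPowerSeries σ ℝ) * (K * MvPowerSeries.pderiv ℝ i Φ * Φ ^ (m - 1))) := by
      rw [← nsmul_eq_mul, map_nsmul, nsmul_eq_mul]
    rw [h₁, h₂, h₃, ← map_sub, ← map_sub]
    congr 1
    have hK' : K' * Φ ^ m * (1 - MvPowerSeries.pderiv ℝ z Φ)
        = Φ ^ m * (MvPowerSeries.pderiv ℝ i K * (1 - MvPowerSeries.pderiv ℝ z Φ)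
        + MvPowerSeries.pderiv ℝ z K * MvPowerSeries.pderiv ℝ i Φ) := by
      rw [← hK]; ring
    rw [hK']
    simp only [Derivation.leibniz, map_sub, MvPowerSeries.pderiv_pow, smul_eq_mul,
      formal_pderiv_comm i z, MvPowerSeries.pderiv_one]
    ring
  have hsum := Finset.sum_congr rfl fun m (_ : m ∈ Finset.range M) => hstep m
  rw [Finset.sum_sub_distrib, Finset.sum_range_sub', ← Finset.sum_mul] at hsum
  have h0 : T 0 = 0 := by simp [hT]
  have hTM : T M = 0 := by simp only [hT, hM, mul_zero]
  linarith

end Formal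
end ImplicitDD

namespace ImplicitDD

open Set

section Snoc

variable {q : ℕ}

theorem foldr_pderiv_map_castSucc (f : (Fin (q + 1) → ℝ) → ℝ) (l : List (Fin q))
    (v : Fin q → ℝ) (w : ℝ) :
    (l.map Fin.castSucc).foldr pderiv f (Fin.snoc v w)
      = l.foldr pderiv (fun v' => f (Fin.snoc v' w)) v := by
  induction l generalizing v with
  | nil => rfl
  | cons i l ih =>
    simp only [List.map_cons, List.foldr_cons, pderiv, Fin.snoc_castSucc]
    congr 1
    funext s
    rw [← ih, Fin.snoc_update]

theorem foldr_pderiv_replicate_last (f : (Fin (q + 1) → ℝ) → ℝ) (t : ℕ) (v : Fin q → ℝ) (w : ℝ) :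
    (List.replicate t (Fin.last q)).foldr pderiv f (Fin.snoc v w)
      = deriv^[t] (fun z => f (Fin.snoc v z)) w := by
  induction t generalizing w with
  | zero => rfl
  | succ t ih =>
    rw [List.replicate_succ, List.foldr_cons, Function.iterate_succ_apply', pderiv]
    simp only [Fin.snoc_last, Fin.update_snoc_last]
    congr 1
    funext s
    exact ih s

theorem gPDeriv_eq_mPDeriv_snoc (g : (Fin q → ℝ) → ℝ → ℝ) (S : Fin q → ℕ) (t : ℕ)
    (v : Fin q → ℝ) (w : ℝ) :
    gPDeriv g S t v w = mPDeriv (Fin.snoc S t : Fin (q + 1) → ℕ)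
      (fun u => g (Fin.init u) (u (Fin.last q))) (Fin.snoc v w) := by
  have hlist : (List.ofFn fun j : Fin (q + 1) =>
      List.replicate ((Fin.snoc S t : Fin (q + 1) → ℕ) j) j).flatten
      = ((List.ofFn fun j : Fin q => List.replicate (S j) j).flatten).map Fin.castSucc
        ++ List.replicate t (Fin.last q) := by
    rw [List.ofFn_succ_last, List.flatten_append, List.map_flatten, List.map_ofFn]
    simp [Function.comp_def]
  rw [gPDeriv, mPDeriv, mPDeriv, hlist, List.foldr_append, foldr_pderiv_map_castSucc]
  simp only [foldr_pderiv_replicate_last, Fin.init_snoc, Fin.snoc_last]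

/-- The multi-index `(s, t)` as a finitely supported function on `Fin (q + 1)`. -/
noncomputable def snocIndex : (Fin q → ℕ) × ℕ →+ (Fin (q + 1) →₀ ℕ) where
  toFun e := Finsupp.equivFunOnFinite.symm (Fin.snoc e.1 e.2)
  map_zero' := by
    ext j
    refine Fin.lastCases ?_ (fun i => ?_) j <;> simp
  map_add' e e' := by
    ext j
    refine Fin.lastCases ?_ (fun i => ?_) j <;> simp

@[simp]
theorem snocIndex_castSucc (e : (Fin q → ℕ) × ℕ) (i : Fin q) : snocIndex e i.castSucc = e.1 i := by
  simp [snocIndex]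

@[simp]
theorem snocIndex_last (e : (Fin q → ℕ) × ℕ) : snocIndex e (Fin.last q) = e.2 := by
  simp [snocIndex]

theorem coe_snocIndex (e : (Fin q → ℕ) × ℕ) :
    (snocIndex e : Fin (q + 1) → ℕ) = Fin.snoc e.1 e.2 := rfl

theorem snocIndex_injective : Function.Injective (snocIndex (q := q)) := by
  intro e e' h
  refine Prod.ext (funext fun i => ?_) ?_
  · simpa using DFunLike.congr_fun h i.castSucc
  · simpa using DFunLike.congr_fun h (Fin.last q)

theorem snocIndex_mk (n : Fin q → ℕ) (m : ℕ) :
    snocIndex (n, m) = snocIndex (n, 0) + Finsupp.single (Fin.last q) m := by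
  ext j
  refine Fin.lastCases ?_ (fun i => ?_) j
  · simp
  · simp [Finsupp.single_eq_of_ne (Fin.castSucc_lt_last i).ne]

theorem snocIndex_add_single (n : Fin q → ℕ) (i : Fin q) (m : ℕ) :
    snocIndex (n + Pi.single i 1, m)
      = snocIndex (n, 0) + Finsupp.single i.castSucc 1 + Finsupp.single (Fin.last q) m := by
  ext j
  refine Fin.lastCases ?_ (fun k => ?_) j
  · simp [Finsupp.single_eq_of_ne (Fin.castSucc_lt_last i).ne']
  · rcases eq_or_ne k i with rfl | hk
    · simp [Finsupp.single_eq_of_ne (Fin.castSucc_lt_last _).ne]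
    · simp [Finsupp.single_eq_of_ne (Fin.castSucc_lt_last _).ne, hk,
        Finsupp.single_eq_of_ne ((Fin.castSucc_injective q).ne hk)]

/-- The weight on multi-indices giving weight `1` to the last variable and `2` to the others. -/
def lastWeight : (Fin (q + 1) →₀ ℕ) →+ ℕ where
  toFun d := 2 * ∑ i : Fin q, d i.castSucc + d (Fin.last q)
  map_zero' := by simp
  map_add' d d' := by
    simp only [Finsupp.add_apply, Finset.sum_add_distrib]
    ring

theorem lastWeight_snocIndex (e : (Fin q → ℕ) × ℕ) :
    lastWeight (snocIndex e) = 2 * ∑ i, e.1 i + e.2 := by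
  simp [lastWeight]

theorem eq_of_lastWeight_lt_two {d : Fin (q + 1) →₀ ℕ} (hd : lastWeight d < 2) :
    d = 0 ∨ d = Finsupp.single (Fin.last q) 1 := by
  change 2 * ∑ i : Fin q, d i.castSucc + d (Fin.last q) < 2 at hd
  have hsum : ∑ i : Fin q, d i.castSucc = 0 := by omega
  have hcast : ∀ i : Fin q, d i.castSucc = 0 := fun i =>
    Finset.sum_eq_zero_iff.1 hsum i (Finset.mem_univ i)
  have hlast : d (Fin.last q) = 0 ∨ d (Fin.last q) = 1 := by omega
  refine hlast.imp (fun h => ?_) (fun h => ?_) <;> ext j <;>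
    refine Fin.lastCases ?_ (fun k => ?_) j <;>
    simp [h, hcast, Finsupp.single_eq_of_ne (Fin.castSucc_lt_last _).ne]

end Snoc

end ImplicitDD

namespace ImplicitDD

open Set
open MvPowerSeries (coeff)

section Implicit

variable {q : ℕ} {U : Set (Fin q → ℝ)} {W : Set (Fin (q + 1) → ℝ)} {y : (Fin q → ℝ) → ℝ}
  {G k : (Fin (q + 1) → ℝ) → ℝ}

theorem pderiv_comp_graph (hU : IsOpen U) (hW : IsOpen W) (hy : ContDiffOn ℝ (⊤ : ℕ∞) y U)
    (hmaps : ∀ v ∈ U, (Fin.snoc v (y v) : Fin (q + 1) → ℝ) ∈ W)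
    (hk : ContDiffOn ℝ (⊤ : ℕ∞) k W) (i : Fin q) {v : Fin q → ℝ} (hv : v ∈ U) :
    pderiv i (fun v => k (Fin.snoc v (y v))) v
      = pderiv i.castSucc k (Fin.snoc v (y v))
        + pderiv (Fin.last q) k (Fin.snoc v (y v)) * pderiv i y v := by
  have hkd := differentiableAt_of_contDiffOn hW hk (hmaps v hv)
  have hyd := differentiableAt_of_contDiffOn hU hy hv
  have hu := hasDerivAt_update v i (v i)
  have hyu : HasDerivAt (fun s => y (Function.update v i s)) (pderiv i y v) (v i) := by
    rw [pderiv_eq_fderiv i hyd]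
    refine HasFDerivAt.comp_hasDerivAt (v i) (l := y) ?_ hu
    simpa using hyd.hasFDerivAt
  have hcurve : HasDerivAt
      (fun s => (Fin.snoc (Function.update v i s) (y (Function.update v i s)) : Fin (q + 1) → ℝ))
      (Pi.single i.castSucc 1 + pderiv i y v • Pi.single (Fin.last q) 1) (v i) := by
    rw [hasDerivAt_pi] at hu ⊢
    intro j
    refine Fin.lastCases ?_ (fun l => ?_) j
    · simpa [Pi.single_eq_of_ne (Fin.castSucc_lt_last i).ne'] using hyu
    · have := hu l
      rcases eq_or_ne l i with rfl | hl
      · simpa [Pi.single_eq_of_ne (Fin.castSucc_lt_last _).ne] using this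
      · simpa [Pi.single_eq_of_ne (Fin.castSucc_lt_last _).ne, hl,
          Pi.single_eq_of_ne ((Fin.castSucc_injective q).ne hl)] using this
  have hcomp := HasFDerivAt.comp_hasDerivAt (v i) (l := k) (by simpa using hkd.hasFDerivAt) hcurve
  refine hcomp.deriv.trans ?_
  rw [map_add, map_smul, smul_eq_mul, mul_comm, pderiv_eq_fderiv _ hkd, pderiv_eq_fderiv _ hkd]

theorem pderiv_implicit (hU : IsOpen U) (hW : IsOpen W) (hy : ContDiffOn ℝ (⊤ : ℕ∞) y U)
    (hmaps : ∀ v ∈ U, (Fin.snoc v (y v) : Fin (q + 1) → ℝ) ∈ W)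
    (hG : ContDiffOn ℝ (⊤ : ℕ∞) G W) (hzero : ∀ v ∈ U, G (Fin.snoc v (y v)) = 0)
    (hne : ∀ u ∈ W, pderiv (Fin.last q) G u ≠ 0) (i : Fin q) {v : Fin q → ℝ} (hv : v ∈ U) :
    pderiv i y v = -(pderiv i.castSucc G / pderiv (Fin.last q) G) (Fin.snoc v (y v)) := by
  have h := pderiv_comp_graph hU hW hy hmaps hG i hv
  have hz : pderiv i (fun v => G (Fin.snoc v (y v))) v = 0 := by
    rw [pderiv_congr (h := fun _ => 0) hU i hzero hv]
    simp [pderiv]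
  have hne' := hne _ (hmaps v hv)
  rw [hz] at h
  rw [Pi.div_apply]
  field_simp
  linarith

/-- The formal power series `Φ` such that `G = 0` reads `z = Φ(x, z)` in coordinates centered
at `a`. -/
noncomputable def fixedPointSeries (a : Fin (q + 1) → ℝ) (G : (Fin (q + 1) → ℝ) → ℝ) :
    MvPowerSeries (Fin (q + 1)) ℝ :=
  MvPowerSeries.X (Fin.last q) - MvPowerSeries.C (pderiv (Fin.last q) G a)⁻¹ * jet a G

variable {a : Fin (q + 1) → ℝ}

theorem pderiv_castSucc_fixedPointSeries (hW : IsOpen W) (ha : a ∈ W)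
    (hG : ContDiffOn ℝ (⊤ : ℕ∞) G W) (i : Fin q) :
    MvPowerSeries.pderiv ℝ i.castSucc (fixedPointSeries a G)
      = -(MvPowerSeries.C (pderiv (Fin.last q) G a)⁻¹ * jet a (pderiv i.castSucc G)) := by
  simp [fixedPointSeries, Derivation.leibniz, pderiv_jet hW ha hG,
    MvPowerSeries.pderiv_X_of_ne (Fin.castSucc_lt_last i).ne']

theorem pderiv_last_fixedPointSeries (hW : IsOpen W) (ha : a ∈ W)
    (hG : ContDiffOn ℝ (⊤ : ℕ∞) G W) :
    1 - MvPowerSeries.pderiv ℝ (Fin.last q) (fixedPointSeries a G)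
      = MvPowerSeries.C (pderiv (Fin.last q) G a)⁻¹ * jet a (pderiv (Fin.last q) G) := by
  simp [fixedPointSeries, Derivation.leibniz, pderiv_jet hW ha hG]

theorem coeff_fixedPointSeries_of_ne {d : Fin (q + 1) →₀ ℕ}
    (hd : d ≠ Finsupp.single (Fin.last q) 1) :
    coeff d (fixedPointSeries a G)
      = -((pderiv (Fin.last q) G a)⁻¹ * coeff d (jet a G)) := by
  classical
  simp [fixedPointSeries, MvPowerSeries.coeff_X, hd]

theorem coeff_fixedPointSeries_eq_zero (hW : IsOpen W) (ha : a ∈ W)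
    (hG : ContDiffOn ℝ (⊤ : ℕ∞) G W) (hGa : G a = 0) (hne : pderiv (Fin.last q) G a ≠ 0)
    {d : Fin (q + 1) →₀ ℕ} (hd : lastWeight d < 2) : coeff d (fixedPointSeries a G) = 0 := by
  rcases eq_of_lastWeight_lt_two hd with rfl | rfl
  · rw [coeff_fixedPointSeries_of_ne (by simp [eq_comm]), coeff_zero_jet, hGa]
    simp
  · have h := congrArg (coeff 0) (pderiv_last_fixedPointSeries hW ha hG)
    rw [map_sub, MvPowerSeries.coeff_pderiv, MvPowerSeries.coeff_C_mul, coeff_zero_jet,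
      inv_mul_cancel₀ hne] at h
    simpa [-MvPowerSeries.coeff_zero_eq_constantCoeff, MvPowerSeries.coeff_zero_one] using h

/-- Lagrange inversion for the Taylor coefficients of a function along the graph of an implicitly
defined function. -/
theorem coeff_jet_comp_graph (hU : IsOpen U) (hW : IsOpen W) (hy : ContDiffOn ℝ (⊤ : ℕ∞) y U)
    (hmaps : ∀ v ∈ U, (Fin.snoc v (y v) : Fin (q + 1) → ℝ) ∈ W)
    (hG : ContDiffOn ℝ (⊤ : ℕ∞) G W) (hzero : ∀ v ∈ U, G (Fin.snoc v (y v)) = 0)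
    (hne : ∀ u ∈ W, pderiv (Fin.last q) G u ≠ 0) {x : Fin q → ℝ} (hx : x ∈ U)
    (ha : a = Fin.snoc x (y x)) (hk : ContDiffOn ℝ (⊤ : ℕ∞) k W) (n : Fin q →₀ ℕ) {M : ℕ}
    (hM : 2 * ∑ i, n i + 1 ≤ M) :
    coeff n (jet x fun v => k (Fin.snoc v (y v)))
      = ∑ m ∈ Finset.range M, coeff (snocIndex (n, m)) (jet a k * fixedPointSeries a G ^ m
          * (1 - MvPowerSeries.pderiv ℝ (Fin.last q) (fixedPointSeries a G))) := by
  have haW : a ∈ W := ha ▸ hmaps x hx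
  have hΦ : ∀ d, lastWeight d < 2 → coeff d (fixedPointSeries a G) = 0 := fun d hd =>
    coeff_fixedPointSeries_eq_zero hW haW hG (ha ▸ hzero x hx) (hne a haW) hd
  induction n using multiIndex_induction generalizing k with
  | zero =>
    rw [Finset.sum_eq_single_of_mem 0 (by simp; omega)]
    · have h0 : snocIndex (((0 : Fin q →₀ ℕ) : Fin q → ℕ), 0) = 0 := map_zero _
      have h1 := hΦ (Finsupp.single (Fin.last q) 1) (by simp [lastWeight,
        Finsupp.single_eq_of_ne (Fin.castSucc_lt_last _).ne])
      have hmul (A B : MvPowerSeries (Fin (q + 1)) ℝ) : coeff 0 (A * B) = coeff 0 A * coeff 0 B :=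
        map_mul MvPowerSeries.constantCoeff A B
      rw [h0, pow_zero, mul_one, hmul, map_sub, MvPowerSeries.coeff_pderiv,
        zero_add, h1, coeff_zero_jet, coeff_zero_jet, ← ha]
      simp
    · intro m _ hm
      rw [mul_right_comm]
      refine coeff_mul_pow_eq_zero (w := lastWeight) hΦ _ ?_
      rw [lastWeight_snocIndex]
      simp
      omega
  | add_single n i ih =>
    have hsum : ∑ j, (n + Finsupp.single i 1 : Fin q →₀ ℕ) j = ∑ j, n j + 1 := by
      simp [Finset.sum_add_distrib, Finsupp.single_apply]
    rw [hsum] at hM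
    have hi : (n i + 1 : ℝ) ≠ 0 := by positivity
    have hci := contDiffOn_pderiv hW i.castSucc hk
    have hcl := contDiffOn_pderiv hW (Fin.last q) hk
    have hGi := contDiffOn_pderiv hW i.castSucc hG
    have hGl := contDiffOn_pderiv hW (Fin.last q) hG
    set ρ := pderiv i.castSucc G / pderiv (Fin.last q) G with hρ_def
    have hρ : ContDiffOn ℝ (⊤ : ℕ∞) ρ W := hGi.div hGl hne
    have hρG : jet a ρ * jet a (pderiv (Fin.last q) G) = jet a (pderiv i.castSucc G) := by
      rw [← jet_mul hW haW hρ hGl]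
      refine jet_congr hW haW fun u hu => ?_
      simp [hρ_def, hne u hu]
    set κ := pderiv i.castSucc k - pderiv (Fin.last q) k * ρ with hκ_def
    have hκ : ContDiffOn ℝ (⊤ : ℕ∞) κ W := hci.sub (hcl.mul hρ)
    have hjκ : jet a κ = jet a (pderiv i.castSucc k) - jet a (pderiv (Fin.last q) k) * jet a ρ := by
      rw [hκ_def, jet_sub (h := pderiv (Fin.last q) k * ρ) hW haW hci (hcl.mul hρ),
        jet_mul hW haW hcl hρ]
    have hgraph : EqOn (pderiv i fun v => k (Fin.snoc v (y v))) (fun v => κ (Fin.snoc v (y v)))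
        U := by
      intro v hv
      rw [pderiv_comp_graph hU hW hy hmaps hk i hv,
        pderiv_implicit hU hW hy hmaps hG hzero hne i hv]
      simp [hκ_def, hρ_def, sub_eq_add_neg]
    have hkgraph : ContDiffOn ℝ (⊤ : ℕ∞) (fun v => k (Fin.snoc v (y v))) U := by
      refine hk.comp ?_ hmaps
      rw [contDiffOn_pi]
      intro j
      refine Fin.lastCases ?_ (fun l => ?_) j
      · simpa using hy
      · simpa using (contDiff_apply ℝ ℝ l).contDiffOn
    apply mul_right_cancel₀ hi
    rw [← MvPowerSeries.coeff_pderiv, pderiv_jet hU hx hkgraph, jet_congr hU hx hgraph,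
      ih hκ (by omega)]
    simp only [Finsupp.coe_add, Finsupp.single_eq_pi_single, snocIndex_add_single]
    have hstep := sum_coeff_add_single (Φ := fixedPointSeries a G) (K := jet a k) (K' := jet a κ)
      (i := i.castSucc) (z := Fin.last q) (n := snocIndex (n, 0)) (M := M)
      (Fin.castSucc_lt_last i).ne ?_ (by simp) ?_
    · simp only [← snocIndex_mk] at hstep
      rw [← hstep, snocIndex_castSucc]
    · rw [pderiv_last_fixedPointSeries hW haW hG, pderiv_castSucc_fixedPointSeries hW haW hG,
        pderiv_jet hW haW hk, pderiv_jet hW haW hk, hjκ, ← hρG]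
      ring
    · refine coeff_mul_pow_eq_zero (w := lastWeight) hΦ _ ?_
      rw [← snocIndex_mk, lastWeight_snocIndex]
      simp only
      omega

/-- Lagrange inversion for the Taylor coefficients of an implicitly defined function. -/
theorem coeff_jet_implicit (hU : IsOpen U) (hW : IsOpen W) (hy : ContDiffOn ℝ (⊤ : ℕ∞) y U)
    (hmaps : ∀ v ∈ U, (Fin.snoc v (y v) : Fin (q + 1) → ℝ) ∈ W)
    (hG : ContDiffOn ℝ (⊤ : ℕ∞) G W) (hzero : ∀ v ∈ U, G (Fin.snoc v (y v)) = 0)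
    (hne : ∀ u ∈ W, pderiv (Fin.last q) G u ≠ 0) {x : Fin q → ℝ} (hx : x ∈ U)
    (ha : a = Fin.snoc x (y x)) {n : Fin q →₀ ℕ} (hn : n ≠ 0) {M : ℕ}
    (hM : 2 * ∑ i, n i + 1 ≤ M) :
    coeff n (jet x y)
      = ∑ m ∈ Finset.range M,
          1 / ((m + 1 : ℕ) : ℝ) * coeff (snocIndex (n, m)) (fixedPointSeries a G ^ (m + 1)) := by
  have haW : a ∈ W := ha ▸ hmaps x hx
  obtain ⟨i, hi⟩ : ∃ i, n i ≠ 0 := by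
    by_contra! h
    exact hn (Finsupp.ext h)
  have hle : Finsupp.single i 1 ≤ n := by simpa [Nat.one_le_iff_ne_zero] using hi
  obtain ⟨n, rfl⟩ : ∃ n', n = n' + Finsupp.single i 1 := ⟨_, (tsub_add_cancel_of_le hle).symm⟩
  have hsum : ∑ j, (n + Finsupp.single i 1 : Fin q →₀ ℕ) j = ∑ j, n j + 1 := by
    simp [Finset.sum_add_distrib, Finsupp.single_apply]
  have hGi := contDiffOn_pderiv hW i.castSucc hG
  have hGl := contDiffOn_pderiv hW (Fin.last q) hG
  set ρ := -pderiv i.castSucc G / pderiv (Fin.last q) G with hρ_def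
  have hρ : ContDiffOn ℝ (⊤ : ℕ∞) ρ W := hGi.neg.div hGl hne
  have hρG : jet a ρ * jet a (pderiv (Fin.last q) G) = -jet a (pderiv i.castSucc G) := by
    rw [← jet_mul hW haW hρ hGl, ← jet_neg hW haW hGi]
    refine jet_congr hW haW fun u hu => ?_
    simp [hρ_def, hne u hu]
  have hgraph : EqOn (pderiv i y) (fun v => ρ (Fin.snoc v (y v))) U := by
    intro v hv
    rw [pderiv_implicit hU hW hy hmaps hG hzero hne i hv]
    simp [hρ_def, neg_div]
  have hi' : (n i + 1 : ℝ) ≠ 0 := by positivity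
  apply mul_right_cancel₀ hi'
  rw [← MvPowerSeries.coeff_pderiv, pderiv_jet hU hx hy, jet_congr hU hx hgraph,
    coeff_jet_comp_graph hU hW hy hmaps hG hzero hne hx ha hρ n (M := M) (by omega),
    Finset.sum_mul]
  refine Finset.sum_congr rfl fun m _ => ?_
  have hprod : jet a ρ * fixedPointSeries a G ^ m
      * (1 - MvPowerSeries.pderiv ℝ (Fin.last q) (fixedPointSeries a G))
      = fixedPointSeries a G ^ m * MvPowerSeries.pderiv ℝ i.castSucc (fixedPointSeries a G) := by
    rw [pderiv_last_fixedPointSeries hW haW hG, pderiv_castSucc_fixedPointSeries hW haW hG]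
    linear_combination (MvPowerSeries.C (pderiv (Fin.last q) G a)⁻¹
      * fixedPointSeries a G ^ m) * hρG
  have hpow := congrArg (coeff (snocIndex (n, m)))
    (MvPowerSeries.pderiv_pow (i := i.castSucc) (fixedPointSeries a G) (m + 1))
  rw [MvPowerSeries.coeff_pderiv, mul_assoc, ← nsmul_eq_mul, map_nsmul, nsmul_eq_mul,
    Nat.add_sub_cancel, ← hprod, snocIndex_castSucc] at hpow
  have hidx : snocIndex (n, m) + Finsupp.single i.castSucc 1
      = snocIndex (((n + Finsupp.single i 1 : Fin q →₀ ℕ) : Fin q → ℕ), m) := by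
    rw [Finsupp.coe_add, Finsupp.single_eq_pi_single, snocIndex_add_single, snocIndex_mk,
      add_right_comm]
  rw [hidx] at hpow
  have hm : ((m + 1 : ℕ) : ℝ) ≠ 0 := by positivity
  field_simp
  rw [mul_comm, hpow]

end Implicit

end ImplicitDD

namespace ImplicitDD

open MvPowerSeries (coeff)

section Expansion

theorem coeff_pow_congr {σ : Type*} {A B : MvPowerSeries σ ℝ} {b : σ →₀ ℕ}
    (hAB : ∀ d ≤ b, coeff d A = coeff d B) (m : ℕ) {d : σ →₀ ℕ} (hd : d ≤ b) :
    coeff d (A ^ m) = coeff d (B ^ m) := by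
  classical
  induction m generalizing d with
  | zero => rfl
  | succ m ih =>
    rw [pow_succ, pow_succ, MvPowerSeries.coeff_mul, MvPowerSeries.coeff_mul]
    refine Finset.sum_congr rfl fun p hp => ?_
    have hp' := Finset.HasAntidiagonal.mem_antidiagonal.1 hp
    rw [ih ((le_self_add.trans hp'.le).trans hd), hAB _ ((le_add_self.trans hp'.le).trans hd)]

variable {q : ℕ}

theorem prod_map_monomial_snocIndex (α : (Fin q → ℕ) × ℕ → ℝ) (p : Multiset ((Fin q → ℕ) × ℕ)) :
    (p.map fun e => MvPowerSeries.monomial (snocIndex e) (α e)).prod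
      = MvPowerSeries.monomial (snocIndex p.sum) (p.map α).prod := by
  induction p using Multiset.induction_on with
  | empty => simp
  | cons e p ih => simp [ih, MvPowerSeries.monomial_mul_monomial]

open Classical in
theorem coeff_snocIndex_pow (Φ : MvPowerSeries (Fin (q + 1)) ℝ) (b : (Fin q → ℕ) × ℕ) (m : ℕ) :
    coeff (snocIndex b) (Φ ^ m)
      = ∑ k ∈ (Finset.Iic b).sym m, if k.toMultiset.sum = b then
          (k.toMultiset.countPerms : ℝ)
            * (k.toMultiset.map fun e => coeff (snocIndex e) Φ).prod else 0 := by
  have hcongr : ∀ d ≤ snocIndex b, coeff d Φ = coeff d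
      (∑ e ∈ Finset.Iic b, MvPowerSeries.monomial (snocIndex e) (coeff (snocIndex e) Φ)) := by
    intro d hd
    obtain ⟨e, rfl⟩ : ∃ e, d = snocIndex e := by
      refine ⟨(fun i => d i.castSucc, d (Fin.last q)), ?_⟩
      ext j
      refine Fin.lastCases ?_ (fun i => ?_) j <;> simp
    have he : e ≤ b :=
      ⟨fun i => by simpa using hd i.castSucc, by simpa using hd (Fin.last q)⟩
    simp [MvPowerSeries.coeff_monomial, snocIndex_injective.eq_iff, he]
  rw [coeff_pow_congr hcongr m le_rfl, Finset.sum_pow, map_sum]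
  refine Finset.sum_congr rfl fun k _ => ?_
  rw [prod_map_monomial_snocIndex, ← nsmul_eq_mul, map_nsmul, nsmul_eq_mul,
    MvPowerSeries.coeff_monomial]
  by_cases h : k.toMultiset.sum = b
  · exact (congrArg _ (if_pos (congrArg snocIndex h.symm))).trans (if_pos h).symm
  · refine Eq.trans ?_ (if_neg h).symm
    exact (congrArg _ (if_neg fun h' => h (snocIndex_injective h'.symm))).trans (mul_zero _)

theorem countPerms_eq_div {α : Type*} [DecidableEq α] (p : Multiset α) :
    (p.countPerms : ℝ)
      = (p.card.factorial : ℝ) / ∏ e ∈ p.toFinset, ((p.count e).factorial : ℝ) := by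
  have h := Nat.multinomial_spec p.toFinset (fun e => p.count e)
  rw [Multiset.toFinset_sum_count_eq] at h
  rw [eq_div_iff (Finset.prod_ne_zero_iff.2 fun e _ => by positivity), mul_comm]
  have hc : p.countPerms = Nat.multinomial p.toFinset (fun e => p.count e) := by
    rw [Multiset.countPerms, Finsupp.multinomial_eq, Multiset.toFinsupp_support]
    rfl
  rw [hc]
  exact_mod_cast h

/-- The multisets over which the explicit formula is summed. -/
def IsImplicitPartition (n : Fin q → ℕ) (p : Multiset ((Fin q → ℕ) × ℕ)) : Prop :=
  (∀ e ∈ p, e ≠ ((fun _ => 0 : Fin q → ℕ), 0)) ∧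
    ((fun _ => 0 : Fin q → ℕ), 1) ∉ p ∧
    (p.map Prod.fst).sum = n ∧
    (p.map Prod.snd).sum + 1 = Multiset.card p

theorem sum_eq_mk (p : Multiset ((Fin q → ℕ) × ℕ)) :
    p.sum = ((p.map Prod.fst).sum, (p.map Prod.snd).sum) :=
  Prod.ext (map_multiset_sum (AddMonoidHom.fst _ _) p) (map_multiset_sum (AddMonoidHom.snd _ _) p)

theorem two_le_lastWeight {e : (Fin q → ℕ) × ℕ} (h₀ : e ≠ ((fun _ => 0 : Fin q → ℕ), 0))
    (h₁ : e ≠ ((fun _ => 0 : Fin q → ℕ), 1)) : 2 ≤ lastWeight (snocIndex e) := by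
  by_contra! h
  rcases eq_of_lastWeight_lt_two h with he | he
  · exact h₀ (snocIndex_injective (he.trans (map_zero snocIndex).symm))
  · refine h₁ (snocIndex_injective (he.trans ?_))
    have h0 : snocIndex ((fun _ => 0 : Fin q → ℕ), 0) = 0 := map_zero snocIndex
    rw [snocIndex_mk, h0, zero_add]

theorem IsImplicitPartition.card_le {n : Fin q → ℕ} {p : Multiset ((Fin q → ℕ) × ℕ)}
    (hp : IsImplicitPartition n p) : p.card ≤ 2 * ∑ i, n i := by
  obtain ⟨h₀, h₁, hn, hc⟩ := hp
  have hw : p.card • 2 ≤ (p.map fun e => lastWeight (snocIndex e)).sum := by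
    have := Multiset.card_nsmul_le_sum (s := p.map fun e => lastWeight (snocIndex e)) (a := 2) ?_
    · simpa using this
    · intro b hb
      obtain ⟨e, he, rfl⟩ := Multiset.mem_map.1 hb
      exact two_le_lastWeight (h₀ e he) fun h => h₁ (h ▸ he)
  have hs : (p.map fun e => lastWeight (snocIndex e)).sum
      = 2 * ∑ i, n i + (p.map Prod.snd).sum := by
    have := map_multiset_sum ((lastWeight (q := q)).comp snocIndex) p
    rw [AddMonoidHom.comp_apply, lastWeight_snocIndex, sum_eq_mk, hn] at this
    exact this.symm
  rw [hs, smul_eq_mul] at hw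
  omega

open Classical in
theorem sum_coeff_pow_eq_finsum {Φ : MvPowerSeries (Fin (q + 1)) ℝ}
    (hΦ : ∀ d, lastWeight d < 2 → coeff d Φ = 0) (n : Fin q → ℕ) {M : ℕ}
    (hM : 2 * ∑ i, n i + 1 ≤ M) :
    ∑ m ∈ Finset.range M, 1 / ((m + 1 : ℕ) : ℝ) * coeff (snocIndex (n, m)) (Φ ^ (m + 1))
      = ∑ᶠ (p : Multiset ((Fin q → ℕ) × ℕ)) (_ : IsImplicitPartition n p),
          (1 / (Multiset.card p : ℝ))
            * (((Multiset.card p).factorial : ℝ)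
                / ∏ e ∈ p.toFinset, ((p.count e).factorial : ℝ))
            * (p.map fun e => coeff (snocIndex e) Φ).prod := by
  simp only [finsum_eq_if]
  rw [finsum_eq_sum_of_support_subset (s := (Finset.range M).biUnion fun m =>
    ((Finset.Iic (n, m)).sym (m + 1)).image Sym.toMultiset)]
  · rw [Finset.sum_biUnion]
    · refine Finset.sum_congr rfl fun m _ => ?_
      rw [coeff_snocIndex_pow, Finset.mul_sum,
        Finset.sum_image fun k _ k' _ h => Sym.coe_injective h]
      refine Finset.sum_congr rfl fun k _ => ?_
      obtain ⟨p, hp⟩ : ∃ p : Multiset ((Fin q → ℕ) × ℕ), k.toMultiset = p := ⟨_, rfl⟩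
      have hcard : p.card = m + 1 := hp ▸ k.2
      rw [hp]
      by_cases hpart : IsImplicitPartition n p
      · have hsum : p.sum = (n, m) := by
          obtain ⟨-, -, hn, hc⟩ := hpart
          rw [sum_eq_mk, hn]
          congr 1
          omega
        rw [if_pos hsum, if_pos hpart, countPerms_eq_div, hcard, mul_assoc]
      · rw [if_neg hpart]
        split_ifs with hsum
        · rw [sum_eq_mk, Prod.mk.injEq] at hsum
          have hbad : ∃ e ∈ p, lastWeight (snocIndex e) < 2 := by
            by_contra! hall
            refine hpart ⟨fun e he h => ?_, fun h => ?_, hsum.1, by rw [hsum.2, hcard]⟩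
            · have := hall e he
              rw [h, lastWeight_snocIndex] at this
              simp at this
            · have := hall _ h
              rw [lastWeight_snocIndex] at this
              simp at this
          obtain ⟨e, he, hlt⟩ := hbad
          rw [Multiset.prod_eq_zero (Multiset.mem_map.2 ⟨e, he, hΦ _ hlt⟩), mul_zero, mul_zero]
        · rw [mul_zero]
    · intro m _ m' _ hmm
      refine Finset.disjoint_left.2 fun p hp hp' => hmm ?_
      obtain ⟨k, -, rfl⟩ := Finset.mem_image.1 hp
      obtain ⟨k', -, hk'⟩ := Finset.mem_image.1 hp'
      have h := k'.card_coe
      rw [hk', k.card_coe] at h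
      omega
  · intro p hp
    have hpart : IsImplicitPartition n p := by
      by_contra h
      exact hp (if_neg h)
    have hcard := hpart.card_le
    obtain ⟨h₀, h₁, hn, hc⟩ := hpart
    refine Finset.mem_coe.2 (Finset.mem_biUnion.2 ⟨(p.map Prod.snd).sum, ?_, ?_⟩)
    · rw [Finset.mem_range]
      omega
    · refine Finset.mem_image.2 ⟨Sym.mk p hc.symm, Finset.mem_sym_iff.2 fun e he => ?_, rfl⟩
      rw [Finset.mem_Iic, ← hn, ← sum_eq_mk]
      exact Multiset.le_sum_of_mem he

end Expansion

open Classical in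
/-- (Formula of Comtet–Fiolet–Wilde, generalized.) If `y` is implicitly
defined by `g` on an open box `U` (with values in an open interval `V`), both sufficiently
smooth, then for any `x ∈ U` and nonzero `n ∈ ℕ^q`,
`y_n(x)/n! = ∑_{p ⊢ (n,|p|−1), (0,1) ∉ p} (1/|p|) (|p|!/∏ μ_{p;s,t}!)
∏_{(s,t) ∈ p} (−(1/(s! t!)) g_{s,t}/g_{0,1})`. -/
theorem implicit_partial_derivatives
    {q : ℕ} (lo hi : Fin q → ℝ) (c d : ℝ)
    (y : (Fin q → ℝ) → ℝ) (g : (Fin q → ℝ) → ℝ → ℝ)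
    (hmaps : ∀ v ∈ Set.univ.pi fun j => Set.Ioo (lo j) (hi j), y v ∈ Set.Ioo c d)
    (hsmoothg : ContDiffOn ℝ (⊤ : ℕ∞) (fun p : (Fin q → ℝ) × ℝ => g p.1 p.2)
      ((Set.univ.pi fun j => Set.Ioo (lo j) (hi j)) ×ˢ Set.Ioo c d))
    (hsmoothy : ContDiffOn ℝ (⊤ : ℕ∞) y (Set.univ.pi fun j => Set.Ioo (lo j) (hi j)))
    (himp : ∀ v ∈ Set.univ.pi fun j => Set.Ioo (lo j) (hi j), g v (y v) = 0)
    (hdy : ∀ v ∈ Set.univ.pi fun j => Set.Ioo (lo j) (hi j), deriv (g v) (y v) ≠ 0) :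
    ∀ x ∈ Set.univ.pi fun j => Set.Ioo (lo j) (hi j), ∀ n : Fin q → ℕ, n ≠ (fun _ => 0) →
      mPDeriv n y x / ∏ j, ((n j).factorial : ℝ)
        = ∑ᶠ (p : Multiset ((Fin q → ℕ) × ℕ))
            (_ : (∀ e ∈ p, e ≠ ((fun _ => 0 : Fin q → ℕ), 0)) ∧
              ((fun _ => 0 : Fin q → ℕ), 1) ∉ p ∧
              (p.map Prod.fst).sum = n ∧
              (p.map Prod.snd).sum + 1 = Multiset.card p),
            (1 / (Multiset.card p : ℝ))
              * (((Multiset.card p).factorial : ℝ)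
                  / ∏ e ∈ p.toFinset, ((p.count e).factorial : ℝ))
              * (p.map fun e =>
                  -(1 / ((∏ r, ((e.1 r).factorial : ℝ)) * ((e.2).factorial : ℝ)))
                    * (gPDeriv g e.1 e.2 x (y x) / deriv (g x) (y x))).prod := by
  intro x hx n hn
  set U : Set (Fin q → ℝ) := Set.univ.pi fun j => Set.Ioo (lo j) (hi j) with hU_def
  have hU : IsOpen U := isOpen_set_pi Set.finite_univ fun j _ => isOpen_Ioo
  set G : (Fin (q + 1) → ℝ) → ℝ := fun u => g (Fin.init u) (u (Fin.last q)) with hG_def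
  set split : (Fin (q + 1) → ℝ) → (Fin q → ℝ) × ℝ := fun u => (Fin.init u, u (Fin.last q))
    with hsplit_def
  have hsplit : ContDiff ℝ (⊤ : ℕ∞) split :=
    (contDiff_pi.2 fun i : Fin q => contDiff_apply ℝ ℝ (Fin.castSucc i)).prodMk
      (contDiff_apply ℝ ℝ (Fin.last q))
  set W₀ : Set (Fin (q + 1) → ℝ) := split ⁻¹' (U ×ˢ Set.Ioo c d) with hW₀_def
  have hW₀ : IsOpen W₀ := (hU.prod isOpen_Ioo).preimage hsplit.continuous
  have hG₀ : ContDiffOn ℝ (⊤ : ℕ∞) G W₀ :=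
    hsmoothg.comp hsplit.contDiffOn (Set.mapsTo_preimage _ _)
  set W : Set (Fin (q + 1) → ℝ) := W₀ ∩ pderiv (Fin.last q) G ⁻¹' {0}ᶜ with hW_def
  have hW : IsOpen W :=
    (contDiffOn_pderiv hW₀ _ hG₀).continuousOn.isOpen_inter_preimage hW₀ isOpen_compl_singleton
  have hG : ContDiffOn ℝ (⊤ : ℕ∞) G W := hG₀.mono Set.inter_subset_left
  have hlast : ∀ v w, pderiv (Fin.last q) G (Fin.snoc v w) = deriv (g v) w := by
    intro v w
    simp [pderiv, hG_def]
  have hgraph : ∀ v ∈ U, (Fin.snoc v (y v) : Fin (q + 1) → ℝ) ∈ W := by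
    intro v hv
    refine ⟨?_, ?_⟩
    · simpa [hW₀_def, hsplit_def] using ⟨hv, hmaps v hv⟩
    · simpa [hlast] using hdy v hv
  have hzero : ∀ v ∈ U, G (Fin.snoc v (y v)) = 0 := by
    intro v hv
    simpa [hG_def] using himp v hv
  have hne : ∀ u ∈ W, pderiv (Fin.last q) G u ≠ 0 := fun u hu => hu.2
  have hn' : Finsupp.equivFunOnFinite.symm n ≠ 0 := fun h =>
    hn (congrArg Finsupp.equivFunOnFinite h)
  have hcoeff := coeff_jet_implicit hU hW hsmoothy hgraph hG hzero hne hx rfl hn' le_rfl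
  rw [coeff_jet] at hcoeff
  simp only [Finsupp.coe_equivFunOnFinite_symm] at hcoeff
  rw [hcoeff, sum_coeff_pow_eq_finsum (fun d hd => coeff_fixedPointSeries_eq_zero hW
    (hgraph x hx) hG (hzero x hx) (hne _ (hgraph x hx)) hd) n le_rfl]
  refine finsum_congr fun p => finsum_congr fun hp => ?_
  congr 2
  refine Multiset.map_congr rfl fun e he => ?_
  have hne₁ : snocIndex e ≠ Finsupp.single (Fin.last q) 1 := by
    intro h
    have h0 : snocIndex ((fun _ => 0 : Fin q → ℕ), 0) = 0 := map_zero snocIndex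
    rw [← zero_add (Finsupp.single (Fin.last q) 1), ← h0, ← snocIndex_mk] at h
    exact hp.2.1 (snocIndex_injective h ▸ he)
  rw [coeff_fixedPointSeries_of_ne hne₁, coeff_jet, hlast, gPDeriv_eq_mPDeriv_snoc,
    coe_snocIndex, Fin.prod_univ_castSucc]
  simp only [Fin.snoc_castSucc, Fin.snoc_last]
  ring

end ImplicitDD
end

section
/- Fix q ≥ 1, n ∈ ℕ^q nonzero, and a strictly increasing sequence i = (i₀,…,i_k) in ℕ^q with 0 = i₀ < ⋯ < i_k = n and k ≥ 2. Then there is a bijection between (i) the set 𝒫_i, defined as the Cartesian product, over those j ∈ {1,…,k} with m := |i_j − i_{j−1}| ≥ 2, of the disjoint union over all unit-step lattice paths i_{j−1} = q₀ < q₁ < ⋯ < q_m = i_j of the sets 𝒫(q₀,…,q_m) of polygon partitions, and (ii) the set of pairs consisting of a unit-step lattice path 0 = p₀ < ⋯ < p_{|n|} = n together with a polygon partition π ∈ 𝒫(p₀,…,p_{|n|}) having i = (i₀,…,i_k) as one of its faces; the bijection maps a tuple (π₁, π₂, …) ∈ 𝒫_i to the partition π whose face set is {i} ∪ F(π₁)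 ∪ F(π₂) ∪ ⋯. -/
namespace ImplicitDD

/-- The `r`-th standard unit multi-index in `ℕ^q`. -/
def unitv (q : ℕ) (r : Fin q) : Fin q → ℕ := fun j => if j = r then 1 else 0

end ImplicitDD

namespace ImplicitDD

/-- The face of a dissection of the convex polygon with vertices `0, 1, …, N` whose top edge is
`(a, b)`: it consists of `a`, `b`, and all vertices `a < v < b` that are not strictly below
another edge of the dissection nested below `(a, b)`. -/
def faceOf (D : Finset (ℕ × ℕ)) (a b : ℕ) : Finset ℕ :=
  (Finset.Icc a b).filter fun v =>
    v = a ∨ v = b ∨ ∀ e ∈ D, a ≤ e.1 → e.2 ≤ b → e ≠ (a, b) → ¬(e.1 < v ∧ v < e.2)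

/-- A partition of the convex polygon with ordered vertices `0, 1, …, N`: a set of pairwise
noncrossing straight line segments (diagonals) between nonadjacent vertices. -/
structure PolyPartition (N : ℕ) where
  /-- The set of diagonals `(a, b)` with `a < b`, connecting nonadjacent vertices. -/
  diags : Finset (ℕ × ℕ)
  valid : ∀ e ∈ diags, e.1 + 2 ≤ e.2 ∧ e.2 ≤ N ∧ ¬(e.1 = 0 ∧ e.2 = N)
  noncross : ∀ e ∈ diags, ∀ e' ∈ diags, ¬(e.1 < e'.1 ∧ e'.1 < e.2 ∧ e.2 < e'.2)

/-- The set `F(π)` of (bounded, oriented) faces of a polygon partition, each face recorded as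
the set of its vertices; every face has a unique top edge, which is either a diagonal or the
outer edge `(0, N)`. -/
def PolyPartition.faces {N : ℕ} (π : PolyPartition N) : Finset (Finset ℕ) :=
  (insert (0, N) π.diags).image fun e => faceOf π.diags e.1 e.2

end ImplicitDD

namespace ImplicitDD

/-- `|b − a| = ∑_j (b_j − a_j)`, the length of a multi-index step. -/
def dist {q : ℕ} (a b : Fin q → ℕ) : ℕ := ∑ j, (b j - a j)

/-- The finite sequence `f` extended to all of `ℕ` (constant beyond index `N`). -/
def extF {q N : ℕ} (f : Fin (N + 1) → Fin q → ℕ) : ℕ → Fin q → ℕ :=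
  fun m => f ⟨min m N, Nat.lt_succ_of_le (min_le_right m N)⟩

/-- `f` encodes a unit-step lattice path `a = q₀ < q₁ < ⋯ < q_N = b`. -/
def IsUPath {q N : ℕ} (a b : Fin q → ℕ) (f : Fin (N + 1) → Fin q → ℕ) : Prop :=
  f 0 = a ∧ f (Fin.last N) = b ∧
    ∀ l : ℕ, l < N → ∃ r : Fin q, extF f (l + 1) = fun j => extF f l j + unitv q r j

/-- The set of faces of a polygon partition, each face recorded as the list of the labels of
its vertices, the vertex `l` of the polygon carrying the label `pth l`. -/
def labeledFaces {q N : ℕ} (π : PolyPartition N) (pth : ℕ → Fin q → ℕ) :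
    Finset (List (Fin q → ℕ)) :=
  π.faces.image fun A => (A.sort (· ≤ ·)).map pth

theorem sort_image_of_strictMonoOn {g : ℕ → ℕ} {s : Finset ℕ} (hg : StrictMonoOn g s) :
    (s.image g).sort (· ≤ ·) = (s.sort (· ≤ ·)).map g := by
  refine (Finset.sortedLT_sort _).eq_of_mem_iff ?_ (by simp)
  have h := (Finset.sortedLT_sort s).pairwise
  refine List.Pairwise.sortedLT ((List.pairwise_map).2 ?_)
  exact h.imp_of_mem fun ha hb hab => hg (by simpa using ha) (by simpa using hb) hab

theorem sort_image_range_succ {t : ℕ → ℕ} {k : ℕ} (ht : StrictMonoOn t (Set.Iic k)) :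
    ((Finset.range (k + 1)).image t).sort (· ≤ ·) = (List.range (k + 1)).map t := by
  rw [sort_image_of_strictMonoOn, Finset.sort_range]
  intro a ha b hb hab
  simp only [Finset.coe_range, Set.mem_Iio] at ha hb
  exact ht (Set.mem_Iic.2 (by omega)) (Set.mem_Iic.2 (by omega)) hab

theorem mem_faceOf {D : Finset (ℕ × ℕ)} {a b v : ℕ} :
    v ∈ faceOf D a b ↔ (a ≤ v ∧ v ≤ b) ∧
      (v = a ∨ v = b ∨ ∀ e ∈ D, a ≤ e.1 → e.2 ≤ b → e ≠ (a, b) → ¬(e.1 < v ∧ v < e.2)) := by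
  simp [faceOf]

@[ext]
theorem PolyPartition.ext {N : ℕ} {π π' : PolyPartition N} (h : π.diags = π'.diags) : π = π' := by
  cases π; cases π'; cases h; rfl

/-- The partition induced on the sub-polygon with vertices `s, …, s + m`, renumbered from `0`. -/
def PolyPartition.restrict {N : ℕ} (π : PolyPartition N) (s m : ℕ) : PolyPartition m where
  diags := (Finset.range (m + 1) ×ˢ Finset.range (m + 1)).filter fun e =>
    (s + e.1, s + e.2) ∈ π.diags ∧ e ≠ (0, m)
  valid := by
    rintro ⟨x, y⟩ h
    simp only [Finset.mem_filter, Finset.mem_product, Finset.mem_range, ne_eq,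
      Prod.mk.injEq] at h
    have := (π.valid _ h.2.1).1
    refine ⟨?_, ?_, h.2.2⟩ <;> dsimp only at * <;> omega
  noncross := by
    intro e h e' h'
    simp only [Finset.mem_filter] at h h'
    have := π.noncross _ h.2.1 _ h'.2.1
    dsimp only at this
    omega

theorem PolyPartition.mem_restrict_diags {N : ℕ} {π : PolyPartition N} {s m x y : ℕ} :
    (x, y) ∈ (π.restrict s m).diags ↔
      (s + x, s + y) ∈ π.diags ∧ y ≤ m ∧ (x, y) ≠ (0, m) := by
  simp only [PolyPartition.restrict, Finset.mem_filter, Finset.mem_product, Finset.mem_range]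
  constructor
  · rintro ⟨h, h1, h2⟩
    exact ⟨h1, by omega, h2⟩
  · rintro ⟨h1, h, h2⟩
    have := (π.valid _ h1).1
    dsimp only at this
    exact ⟨by omega, h1, h2⟩

theorem PolyPartition.faceOf_restrict {N : ℕ} (π : PolyPartition N) {s m x y : ℕ} (hy : y ≤ m) :
    (faceOf (π.restrict s m).diags x y).image (s + ·) = faceOf π.diags (s + x) (s + y) := by
  ext w
  simp only [Finset.mem_image, mem_faceOf]
  constructor
  · rintro ⟨v, ⟨hv, h⟩, rfl⟩
    refine ⟨by omega, ?_⟩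
    rcases h with h | h | h
    · left; omega
    · right; left; omega
    · right; right
      rintro ⟨c, d⟩ he h1 h2 h3
      have hcd := (π.valid _ he).1
      dsimp only at h1 h2 hcd ⊢
      obtain ⟨c, rfl⟩ := Nat.exists_eq_add_of_le (show s ≤ c by omega)
      obtain ⟨d, rfl⟩ := Nat.exists_eq_add_of_le (show s ≤ d by omega)
      have hne : (c, d) ≠ (x, y) := by
        rintro ⟨⟩; exact h3 rfl
      have := h (c, d) (π.mem_restrict_diags.2 ⟨he, by omega, ?_⟩) (by dsimp only; omega)
        (by dsimp only; omega) hne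
      · dsimp only at this; omega
      · rintro ⟨⟩
        exact hne (by ext <;> dsimp only <;> omega)
  · rintro ⟨hw, h⟩
    obtain ⟨v, rfl⟩ := Nat.exists_eq_add_of_le (show s ≤ w by omega)
    refine ⟨v, ⟨by omega, ?_⟩, rfl⟩
    rcases h with h | h | h
    · left; omega
    · right; left; omega
    · right; right
      rintro ⟨c, d⟩ he h1 h2 h3
      obtain ⟨he, hd, hne⟩ := π.mem_restrict_diags.1 he
      have := h _ he (by dsimp only at *; omega) (by dsimp only at *; omega) (by simpa using h3)
      dsimp only at *
      omega

theorem mem_labeledFaces {q N : ℕ} {π : PolyPartition N} {p : ℕ → Fin q → ℕ}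
    {L : List (Fin q → ℕ)} :
    L ∈ labeledFaces π p ↔ ∃ a b, ((a, b) = (0, N) ∨ (a, b) ∈ π.diags) ∧
      ((faceOf π.diags a b).sort (· ≤ ·)).map p = L := by
  simp only [labeledFaces, PolyPartition.faces, Finset.image_image, Finset.mem_image,
    Finset.mem_insert, Prod.exists, Function.comp_apply]

theorem mem_labeledFaces_restrict {q N : ℕ} {π : PolyPartition N} {p p' : ℕ → Fin q → ℕ}
    {s m : ℕ} (hp : ∀ v ≤ m, p' v = p (s + v)) {L : List (Fin q → ℕ)} :
    L ∈ labeledFaces (π.restrict s m) p' ↔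
      ∃ x y, y ≤ m ∧ ((x, y) = (0, m) ∨ (s + x, s + y) ∈ π.diags) ∧
        ((faceOf π.diags (s + x) (s + y)).sort (· ≤ ·)).map p = L := by
  have key : ∀ x y, y ≤ m →
      ((faceOf (π.restrict s m).diags x y).sort (· ≤ ·)).map p' =
        ((faceOf π.diags (s + x) (s + y)).sort (· ≤ ·)).map p := by
    intro x y hy
    rw [← π.faceOf_restrict hy, sort_image_of_strictMonoOn (fun a _ b _ h => by simpa using h),
      List.map_map]
    refine List.map_congr_left fun v hv => hp v ?_
    have := (mem_faceOf.1 ((Finset.mem_sort _).1 hv)).1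
    omega
  rw [mem_labeledFaces]
  constructor
  · rintro ⟨x, y, h | h, rfl⟩
    · cases h
      exact ⟨0, m, le_rfl, Or.inl rfl, (key _ _ le_rfl).symm⟩
    · have h' := π.mem_restrict_diags.1 h
      exact ⟨x, y, h'.2.1, Or.inr h'.1, (key _ _ h'.2.1).symm⟩
  · rintro ⟨x, y, hy, h, rfl⟩
    refine ⟨x, y, ?_, key _ _ hy⟩
    by_cases hxy : (x, y) = (0, m)
    · exact Or.inl hxy
    · exact Or.inr (π.mem_restrict_diags.2 ⟨h.resolve_left hxy, hy, hxy⟩)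

theorem exists_block {t : ℕ → ℕ} (h0 : t 0 = 0) :
    ∀ {k v : ℕ}, v < t k → ∃ l < k, t l ≤ v ∧ v < t (l + 1)
  | 0, v, h => by omega
  | k + 1, v, h => by
    by_cases hv : v < t k
    · obtain ⟨l, hl, h⟩ := exists_block h0 hv
      exact ⟨l, by omega, h⟩
    · exact ⟨k, by omega, by omega, h⟩

theorem lt_of_strictMonoOn_lt {t : ℕ → ℕ} {k a b : ℕ} (ht : StrictMonoOn t (Set.Iic k))
    (ha : a ≤ k) (hb : b ≤ k) (h : t a < t b) : a < b :=
  (ht.lt_iff_lt ha hb).1 h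

/-- Every segment of `D` lies over one of the blocks `[t l, t (l + 1)]` with `l < k`, and the chords
of the blocks of length at least two belong to `D`. -/
def SplitsAt (D : Finset (ℕ × ℕ)) (t : ℕ → ℕ) (k : ℕ) : Prop :=
  (∀ e ∈ D, ∃ l < k, t l ≤ e.1 ∧ e.2 ≤ t (l + 1)) ∧
    ∀ l < k, t l + 2 ≤ t (l + 1) → (t l, t (l + 1)) ∈ D

theorem PolyPartition.faceOf_top_iff {N k : ℕ} (π : PolyPartition N) {t : ℕ → ℕ}
    (ht : StrictMonoOn t (Set.Iic k)) (h0 : t 0 = 0) (hN : t k = N) :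
    faceOf π.diags 0 N = (Finset.range (k + 1)).image t ↔ SplitsAt π.diags t k := by
  have hle : ∀ {a b}, a ≤ b → b ≤ k → t a ≤ t b := fun {a b} hab hb =>
    ht.monotoneOn (Set.mem_Iic.2 (hab.trans hb)) (Set.mem_Iic.2 hb) hab
  have htop : ∀ {v}, v ∈ faceOf π.diags 0 N ↔
      v ≤ N ∧ ∀ e ∈ π.diags, ¬(e.1 < v ∧ v < e.2) := by
    intro v
    rw [mem_faceOf]
    constructor
    · rintro ⟨hv, h⟩
      refine ⟨hv.2, fun e he hev => ?_⟩
      have hval := π.valid e he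
      rcases h with h | h | h
      · omega
      · omega
      · refine h e he (Nat.zero_le _) hval.2.1 ?_ hev
        rintro rfl
        exact hval.2.2 ⟨rfl, rfl⟩
    · rintro ⟨hv, h⟩
      exact ⟨⟨Nat.zero_le _, hv⟩, Or.inr (Or.inr fun e he _ _ _ => h e he)⟩
  constructor
  · intro h
    have hmem : ∀ l ≤ k, ∀ e ∈ π.diags, ¬(e.1 < t l ∧ t l < e.2) := fun l hl =>
      (htop.1 (h ▸ Finset.mem_image_of_mem t (Finset.mem_range.2 (by omega)))).2
    have hcov : ∀ l < k, ∀ v, t l < v → v < t (l + 1) → ∃ e ∈ π.diags, e.1 < v ∧ v < e.2 := by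
      intro l hl v h1 h2
      by_contra! hcon
      have hv : v ∈ faceOf π.diags 0 N :=
        htop.2 ⟨by have := hle (show l + 1 ≤ k by omega) le_rfl; omega,
          fun e he hev => absurd (hcon e he hev.1) (by omega)⟩
      rw [h, Finset.mem_image] at hv
      obtain ⟨a, ha, rfl⟩ := hv
      have ha' := Finset.mem_range.1 ha
      have := lt_of_strictMonoOn_lt ht (by omega) (by omega) h1
      have := lt_of_strictMonoOn_lt ht (by omega) (by omega) h2
      omega
    refine ⟨fun e he => ?_, fun l hl h2 => ?_⟩
    · have hval := π.valid e he
      obtain ⟨l, hl, h1, h2⟩ := exists_block h0 (show e.1 < t k by omega)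
      refine ⟨l, hl, h1, ?_⟩
      have := hmem (l + 1) (by omega) e he
      omega
    · obtain ⟨e, he, hmax⟩ := Finset.exists_max_image
        (π.diags.filter fun e => e.1 < t l + 1 ∧ t l + 1 < e.2) (fun e => e.2)
        (by
          obtain ⟨e, he, h⟩ := hcov l hl (t l + 1) (by omega) (by omega)
          exact ⟨e, Finset.mem_filter.2 ⟨he, h⟩⟩)
      obtain ⟨he, h3, h4⟩ := Finset.mem_filter.1 he
      have h5 := hmem l (by omega) e he
      have h6 := hmem (l + 1) (by omega) e he
      have h7 : e.2 = t (l + 1) := by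
        by_contra hne
        obtain ⟨e', he', h8, h9⟩ := hcov l hl e.2 (by omega) (by omega)
        have h10 := π.noncross e he e' he'
        have := hmax e' (Finset.mem_filter.2 ⟨he', by omega, by omega⟩)
        omega
      have h8 : e.1 = t l := by omega
      rw [← h7, ← h8]
      exact he
  · rintro ⟨h1, h2⟩
    ext v
    rw [htop, Finset.mem_image]
    constructor
    · rintro ⟨hv, h⟩
      rcases hv.lt_or_eq with hv | rfl
      · obtain ⟨l, hl, h3, h4⟩ := exists_block h0 (show v < t k by omega)
        refine ⟨l, Finset.mem_range.2 (by omega), ?_⟩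
        by_contra hne
        exact h _ (h2 l hl (by omega)) ⟨by dsimp only; omega, h4⟩
      · exact ⟨k, by simp, hN⟩
    · rintro ⟨a, ha, rfl⟩
      have ha' := Finset.mem_range.1 ha
      refine ⟨hN ▸ hle (by omega) le_rfl, fun e he hev => ?_⟩
      obtain ⟨l, hl, h3, h4⟩ := h1 e he
      have := lt_of_strictMonoOn_lt ht (show l ≤ k by omega) (show a ≤ k by omega) (by omega)
      have := lt_of_strictMonoOn_lt ht (show a ≤ k by omega) (show l + 1 ≤ k by omega) (by omega)
      omega

theorem SplitsAt.subset_of_restrict_eq {N k : ℕ} {π π' : PolyPartition N} {t d : ℕ → ℕ}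
    (hd : ∀ l < k, t l + d l = t (l + 1))
    (h : SplitsAt π.diags t k) (h' : SplitsAt π'.diags t k)
    (heq : ∀ l < k, t l + 2 ≤ t (l + 1) →
      π.restrict (t l) (d l) = π'.restrict (t l) (d l)) :
    π.diags ⊆ π'.diags := by
  rintro ⟨a, b⟩ he
  obtain ⟨l, hl, h1, h2⟩ := h.1 _ he
  have hab := (π.valid _ he).1
  have hdl := hd l hl
  dsimp only at h1 h2 hab
  by_cases hc : a = t l ∧ b = t (l + 1)
  · rw [hc.1, hc.2]
    exact h'.2 l hl (by omega)
  · obtain ⟨x, rfl⟩ := Nat.exists_eq_add_of_le h1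
    obtain ⟨y, rfl⟩ := Nat.exists_eq_add_of_le (show t l ≤ b by omega)
    have hm : (x, y) ∈ (π.restrict (t l) (d l)).diags :=
      π.mem_restrict_diags.2 ⟨he, by omega, by simp only [ne_eq, Prod.mk.injEq]; omega⟩
    rw [heq l hl (by omega)] at hm
    exact (π'.mem_restrict_diags.1 hm).1

/-- Partitions of the blocks `[t l, t (l + 1)]` glue to a partition of the whole polygon. -/
theorem exists_glued_partition {N k : ℕ} (hk : 2 ≤ k) {t d : ℕ → ℕ}
    (hd : ∀ l < k, t l + d l = t (l + 1))
    (ht : StrictMonoOn t (Set.Iic k)) (h0 : t 0 = 0) (hN : t k = N)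
    (E : ∀ l, PolyPartition (d l)) :
    ∃ π : PolyPartition N, SplitsAt π.diags t k ∧
      ∀ l < k, t l + 2 ≤ t (l + 1) → π.restrict (t l) (d l) = E l := by
  have hle : ∀ {a b}, a ≤ b → b ≤ k → t a ≤ t b := fun {a b} hab hb =>
    ht.monotoneOn (Set.mem_Iic.2 (hab.trans hb)) (Set.mem_Iic.2 hb) hab
  let D : Finset (ℕ × ℕ) := ((Finset.range k).filter fun l => t l + 2 ≤ t (l + 1)).biUnion
    fun l => insert (t l, t (l + 1)) ((E l).diags.image fun e => (t l + e.1, t l + e.2))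
  have hD : ∀ {a b}, (a, b) ∈ D ↔ ∃ l < k, ∃ x y, a = t l + x ∧ b = t l + y ∧ x + 2 ≤ y ∧
      t l + y ≤ t (l + 1) ∧ ((x = 0 ∧ t l + y = t (l + 1)) ∨ (x, y) ∈ (E l).diags) := by
    intro a b
    simp only [D, Finset.mem_biUnion, Finset.mem_filter, Finset.mem_range, Finset.mem_insert,
      Finset.mem_image, Prod.mk.injEq]
    constructor
    · rintro ⟨l, ⟨hl, h2⟩, ⟨rfl, rfl⟩ | ⟨⟨x, y⟩, he, rfl, rfl⟩⟩ <;> have hdl := hd l hl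
      · exact ⟨l, hl, 0, d l, by omega, by omega, by omega, by omega,
          Or.inl ⟨rfl, by omega⟩⟩
      · have := (E l).valid _ he
        dsimp only at this
        exact ⟨l, hl, x, y, rfl, rfl, by omega, by omega, Or.inr he⟩
    · rintro ⟨l, hl, x, y, rfl, rfl, h2, h3, ⟨rfl, h4⟩ | he⟩
      · exact ⟨l, ⟨hl, by omega⟩, Or.inl ⟨rfl, h4⟩⟩
      · exact ⟨l, ⟨hl, by omega⟩, Or.inr ⟨(x, y), he, rfl, rfl⟩⟩
  have hsame : ∀ {l l'}, l < k → l' < k → t l < t (l' + 1) → t l' < t (l + 1) → l = l' := by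
    intro l l' hl hl' h1 h2
    have := lt_of_strictMonoOn_lt ht (by omega) (by omega) h1
    have := lt_of_strictMonoOn_lt ht (by omega) (by omega) h2
    omega
  let π : PolyPartition N :=
    { diags := D
      valid := by
        rintro ⟨a, b⟩ he
        obtain ⟨l, hl, x, y, rfl, rfl, h2, h3, -⟩ := hD.1 he
        have h4 := hle (show l + 1 ≤ k by omega) le_rfl
        dsimp only
        refine ⟨by omega, by omega, fun h => ?_⟩
        have h5 : ¬ 0 < l := fun h' => by
          have := ht (show 0 ≤ k by omega) (show l ≤ k by omega) h'
          omega
        have h6 : ¬ l + 1 < k := fun h' => by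
          have := ht (show l + 1 ≤ k by omega) (le_refl k) h'
          omega
        omega
      noncross := by
        rintro ⟨a, b⟩ he ⟨a', b'⟩ he' h
        obtain ⟨l, hl, x, y, rfl, rfl, h2, h3, h4⟩ := hD.1 he
        obtain ⟨l', hl', x', y', rfl, rfl, h2', h3', h4'⟩ := hD.1 he'
        dsimp only at h
        obtain rfl := hsame hl hl' (by omega) (by omega)
        rcases h4 with h4 | h4 <;> rcases h4' with h4' | h4'
        · omega
        · omega
        · omega
        · have := (E l).noncross _ h4 _ h4'
          dsimp only at this
          omega }
  refine ⟨π, ⟨?_, ?_⟩, ?_⟩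
  · rintro ⟨a, b⟩ he
    obtain ⟨l, hl, x, y, rfl, rfl, h2, h3, -⟩ := hD.1 he
    exact ⟨l, hl, by dsimp only; omega, h3⟩
  · intro l hl h2
    have hdl := hd l hl
    exact hD.2 ⟨l, hl, 0, d l, by omega, by omega, by omega, by omega,
      Or.inl ⟨rfl, by omega⟩⟩
  · intro l hl h2
    have hdl := hd l hl
    ext ⟨x, y⟩
    rw [π.mem_restrict_diags]
    constructor
    · rintro ⟨he, hy, hne⟩
      obtain ⟨l', hl', x', y', h3, h4, h5, h6, h7⟩ := hD.1 he
      obtain rfl := hsame hl hl' (by omega) (by omega)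
      obtain rfl : x = x' := by omega
      obtain rfl : y = y' := by omega
      refine h7.resolve_left fun h => hne ?_
      ext <;> dsimp only <;> omega
    · intro he
      have hval := (E l).valid _ he
      dsimp only at hval
      exact ⟨hD.2 ⟨l, hl, x, y, rfl, rfl, by omega, by omega, Or.inr he⟩, hval.2.1,
        by simpa using hval.2.2⟩

/-- Labelings of consecutive blocks that agree at the common end points glue. -/
theorem exists_glued_path {α : Type*} {t d : ℕ → ℕ} (P : ℕ → ℕ → α) : ∀ k : ℕ,
    StrictMonoOn t (Set.Iic k) → (∀ l < k, t l + d l = t (l + 1)) →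
    (∀ l, l + 1 < k → P l (d l) = P (l + 1) 0) →
    ∃ p : ℕ → α, ∀ l < k, ∀ m, t l + m ≤ t (l + 1) → p (t l + m) = P l m
  | 0, _, _, _ => ⟨P 0, by simp⟩
  | k + 1, ht, hd, hP => by
    obtain ⟨p, hp⟩ := exists_glued_path P k (ht.mono (Set.Iic_subset_Iic.2 (by omega)))
      (fun l hl => hd l (by omega)) fun l hl => hP l (by omega)
    refine ⟨fun v => if t k < v ∨ k = 0 then P k (v - t k) else p v, fun l hl m hm => ?_⟩
    rcases Nat.lt_succ_iff_lt_or_eq.1 hl with hl | rfl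
    · have : t (l + 1) ≤ t k := ht.monotoneOn (Set.mem_Iic.2 (by omega))
        (Set.mem_Iic.2 (by omega)) (by omega)
      dsimp only
      rw [if_neg (by omega), hp l hl m hm]
    · dsimp only
      rcases Nat.eq_zero_or_pos m with rfl | hm0
      · rcases l with _ | l
        · simp
        · have hlt : t l < t (l + 1) := ht (Set.mem_Iic.2 (by omega))
            (Set.mem_Iic.2 (by omega)) (by omega)
          have hdl := hd l (by omega)
          rw [if_neg (by omega), ← hP l (by omega), ← hp l (by omega) _ (by omega)]
          congr 1
          omega
      · rw [if_pos (by omega)]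
        congr 1
        omega

theorem mem_labeledFaces_of_splitsAt {q N k : ℕ} {π : PolyPartition N} {t d : ℕ → ℕ}
    (hd : ∀ l < k, t l + d l = t (l + 1)) (h : SplitsAt π.diags t k) {p : ℕ → Fin q → ℕ}
    {L : List (Fin q → ℕ)} :
    L ∈ labeledFaces π p ↔ L = ((faceOf π.diags 0 N).sort (· ≤ ·)).map p ∨
      ∃ l < k, 2 ≤ d l ∧ ∃ x y, y ≤ d l ∧ ((x, y) = (0, d l) ∨ (t l + x, t l + y) ∈ π.diags) ∧
        ((faceOf π.diags (t l + x) (t l + y)).sort (· ≤ ·)).map p = L := by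
  rw [mem_labeledFaces]
  constructor
  · rintro ⟨a, b, he | he, rfl⟩
    · cases he
      exact Or.inl rfl
    · right
      obtain ⟨l, hl, h1, h2⟩ := h.1 _ he
      have hab := (π.valid _ he).1
      have hdl := hd l hl
      dsimp only at h1 h2 hab
      obtain ⟨x, rfl⟩ := Nat.exists_eq_add_of_le h1
      obtain ⟨y, rfl⟩ := Nat.exists_eq_add_of_le (show t l ≤ b by omega)
      exact ⟨l, hl, by omega, x, y, by omega, Or.inr he, rfl⟩
  · rintro (rfl | ⟨l, hl, h2, x, y, hy, he | he, rfl⟩)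
    · exact ⟨0, N, Or.inl rfl, rfl⟩
    · cases he
      have hdl := hd l hl
      exact ⟨_, _, Or.inr (by rw [hdl]; exact h.2 l hl (by omega)), rfl⟩
    · exact ⟨_, _, Or.inr he, rfl⟩

/-- Along a path whose vertex `v` has coordinate sum `v`, the sequence `i` labels a face iff it is
the sequence of labels of the top face. -/
theorem map_range_mem_labeledFaces_iff {q N k : ℕ} {π : PolyPartition N} {t : ℕ → ℕ}
    {i : ℕ → Fin q → ℕ} (hti : ∀ l, t l = ∑ j, i l j)
    (ht : StrictMonoOn t (Set.Iic k)) (h0 : t 0 = 0) (hN : t k = N) {p : ℕ → Fin q → ℕ}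
    (hp : ∀ v ≤ N, ∑ j, p v j = v) :
    (List.range (k + 1)).map i ∈ labeledFaces π p ↔
      (∀ l ≤ k, p (t l) = i l) ∧ SplitsAt π.diags t k := by
  have hsort := sort_image_range_succ ht
  rw [← π.faceOf_top_iff ht h0 hN]
  constructor
  · intro h
    obtain ⟨a, b, hab, hL⟩ := mem_labeledFaces.1 h
    have hb : b ≤ N := by
      rcases hab with h | h
      · cases h; exact le_rfl
      · exact (π.valid _ h).2.1
    have hS : (faceOf π.diags a b).sort (· ≤ ·) = (List.range (k + 1)).map t := by
      have := congrArg (List.map fun w : Fin q → ℕ => ∑ j, w j) hL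
      rw [List.map_map, List.map_map] at this
      rw [show t = (fun w : Fin q → ℕ => ∑ j, w j) ∘ i from funext hti, ← this]
      symm
      refine (List.map_congr_left fun v hv => hp v ?_).trans (List.map_id _)
      have := (mem_faceOf.1 ((Finset.mem_sort _).1 hv)).1
      omega
    have hA : faceOf π.diags a b = (Finset.range (k + 1)).image t := by
      rw [← Finset.sort_toFinset (faceOf π.diags a b) (· ≤ ·), hS, ← hsort, Finset.sort_toFinset]
    rw [hS, List.map_map] at hL
    refine ⟨fun l hl => List.map_inj_left.1 hL l (List.mem_range.2 (by omega)), ?_⟩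
    have h1 : t 0 ∈ faceOf π.diags a b := hA ▸ Finset.mem_image_of_mem t (by simp)
    have h2 : t k ∈ faceOf π.diags a b := hA ▸ Finset.mem_image_of_mem t (by simp)
    have h1 := (mem_faceOf.1 h1).1
    have h2 := (mem_faceOf.1 h2).1
    rwa [show a = 0 by omega, show b = N by omega] at hA
  · rintro ⟨h, hF⟩
    refine mem_labeledFaces.2 ⟨0, N, Or.inl rfl, ?_⟩
    rw [hF, hsort, List.map_map]
    exact List.map_congr_left fun l hl => h l (by have := List.mem_range.1 hl; omega)

theorem extF_of_le {q N v : ℕ} (p : ℕ → Fin q → ℕ) (hv : v ≤ N) :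
    extF (fun w : Fin (N + 1) => p w) v = p v := by
  simp [extF, hv]

theorem extF_val {q N : ℕ} (f : Fin (N + 1) → Fin q → ℕ) (v : Fin (N + 1)) :
    extF f v = f v := by
  have : min (v : ℕ) N = v := by omega
  simp [extF, this]

theorem IsUPath.extF_zero {q N : ℕ} {a b : Fin q → ℕ} {f : Fin (N + 1) → Fin q → ℕ}
    (hf : IsUPath a b f) : extF f 0 = a := (extF_val f 0).trans hf.1

theorem IsUPath.extF_last {q N : ℕ} {a b : Fin q → ℕ} {f : Fin (N + 1) → Fin q → ℕ}
    (hf : IsUPath a b f) : extF f N = b := (extF_val f (Fin.last N)).trans hf.2.1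

theorem isUPath_iff {q N : ℕ} {a b : Fin q → ℕ} {p : ℕ → Fin q → ℕ} :
    IsUPath a b (fun w : Fin (N + 1) => p w) ↔ p 0 = a ∧ p N = b ∧
      ∀ l < N, ∃ r : Fin q, p (l + 1) = fun j => p l j + unitv q r j := by
  simp only [IsUPath, Fin.val_zero, Fin.val_last]
  refine and_congr_right fun _ => and_congr_right fun _ => forall₂_congr fun l hl => ?_
  rw [extF_of_le p hl, extF_of_le p hl.le]

theorem IsUPath.sum_extF {q N : ℕ} {a b : Fin q → ℕ} {f : Fin (N + 1) → Fin q → ℕ}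
    (hf : IsUPath a b f) {v : ℕ} (hv : v ≤ N) : ∑ j, extF f v j = ∑ j, a j + v := by
  induction v with
  | zero => rw [hf.extF_zero, add_zero]
  | succ v ih =>
    obtain ⟨r, hr⟩ := hf.2.2 v hv
    rw [hr, Finset.sum_add_distrib, ih (by omega)]
    simp [unitv, add_assoc]

theorem IsUPath.restrict {q N s m : ℕ} {a b : Fin q → ℕ} {f : Fin (N + 1) → Fin q → ℕ}
    (hf : IsUPath a b f) (hs : s + m ≤ N) :
    IsUPath (extF f s) (extF f (s + m)) (fun w : Fin (m + 1) => extF f (s + w)) :=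
  (isUPath_iff (p := fun v => extF f (s + v))).2
    ⟨rfl, rfl, fun l hl => hf.2.2 (s + l) (by omega)⟩

theorem sum_add_dist {q : ℕ} {a b : Fin q → ℕ} (h : a ≤ b) :
    ∑ j, a j + dist a b = ∑ j, b j := by
  rw [dist, ← Finset.sum_add_distrib]
  exact Finset.sum_congr rfl fun j _ => Nat.add_sub_cancel' (h j)

theorem exists_unit_step {q : ℕ} {a b : Fin q → ℕ} (h : a ≤ b) (hab : dist a b = 1) :
    ∃ r : Fin q, b = fun j => a j + unitv q r j := by
  obtain ⟨r, hr⟩ : ∃ r, b - a = Pi.single r 1 := by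
    have hs : ∑ j, (b - a) j = 1 := hab
    obtain ⟨r, -, hr⟩ := Finset.exists_ne_zero_of_sum_ne_zero (hs.trans_ne one_ne_zero)
    refine ⟨r, funext fun j => ?_⟩
    have h1 := Finset.add_sum_erase Finset.univ (b - a) (Finset.mem_univ r)
    by_cases hj : j = r
    · subst hj
      rw [Pi.single_eq_same]
      omega
    · have h2 := Finset.single_le_sum (f := b - a) (fun _ _ => Nat.zero_le _)
        (Finset.mem_erase.2 ⟨hj, Finset.mem_univ j⟩)
      rw [Pi.single_eq_of_ne hj]
      omega
  refine ⟨r, funext fun j => ?_⟩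
  have h1 := congrFun hr j
  have h2 : a j ≤ b j := h j
  simp only [Pi.sub_apply, Pi.single_apply] at h1
  simp only [unitv]
  split_ifs at h1 ⊢ <;> omega

instance (N : ℕ) : Inhabited (PolyPartition N) := ⟨⟨∅, by simp, by simp⟩⟩

/-- For a strictly increasing sequence `0 = i₀ < ⋯ < i_k = n` (`k ≥ 2`) in
`ℕ^q`, there is a bijection between `𝒫_i` (the product, over the `j` with
`|i_j − i_{j−1}| ≥ 2`, of the disjoint union over all unit-step lattice paths
`i_{j−1} = q₀ < ⋯ < q_m = i_j` of the polygon-partition sets `𝒫(q₀,…,q_m)`) and the set of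
pairs of a unit-step lattice path `0 = p₀ < ⋯ < p_{|n|} = n` together with a polygon partition
`π ∈ 𝒫(p₀,…,p_{|n|})` having `(i₀,…,i_k)` as one of its faces; the bijection maps a tuple
`(π₁, π₂, …)` to the partition whose face set is `{i} ∪ F(π₁) ∪ F(π₂) ∪ ⋯`. -/
theorem subpath_partitions_equiv
    {q : ℕ} (n : Fin q → ℕ) (hn : n ≠ fun _ => 0) (k : ℕ) (hk : 2 ≤ k)
    (i : ℕ → Fin q → ℕ)
    (hi0 : i 0 = fun _ => 0) (hik : i k = n)
    (hmono : ∀ a b : ℕ, a < b → b ≤ k → i a < i b) :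
    ∃ e :
      ((j : {j : ℕ // j ∈ (Finset.Icc 1 k).filter fun j => 2 ≤ dist (i (j - 1)) (i j)}) →
        ({f : Fin (dist (i (j.1 - 1)) (i j.1) + 1) → Fin q → ℕ //
            IsUPath (i (j.1 - 1)) (i j.1) f}
          × PolyPartition (dist (i (j.1 - 1)) (i j.1)))) ≃
      (Σ f : {f : Fin ((∑ j', n j') + 1) → Fin q → ℕ // IsUPath (fun _ => 0) n f},
        {π : PolyPartition (∑ j', n j') //
          ((List.range (k + 1)).map i) ∈ labeledFaces π (extF f.1)}),
      ∀ a, labeledFaces (e a).2.1 (extF (e a).1.1)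
        = insert ((List.range (k + 1)).map i)
            (((Finset.Icc 1 k).filter fun j => 2 ≤ dist (i (j - 1)) (i j)).attach.biUnion
              fun j => labeledFaces (a j).2 (extF (a j).1.1)) := by
  let t : ℕ → ℕ := fun l => ∑ r, i l r
  let d : ℕ → ℕ := fun l => dist (i l) (i (l + 1))
  have hti : ∀ l, t l = ∑ r, i l r := fun _ => rfl
  have hd : ∀ l < k, t l + d l = t (l + 1) := fun l hl =>
    sum_add_dist (hmono l (l + 1) (by omega) (by omega)).le
  have ht : StrictMonoOn t (Set.Iic k) := by
    intro a _ b hb hab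
    obtain ⟨hle, r, hr⟩ := Pi.lt_def.1 (hmono a b hab hb)
    exact Finset.sum_lt_sum (fun r _ => hle r) ⟨r, Finset.mem_univ r, hr⟩
  have h0 : t 0 = 0 := by simp [t, hi0]
  have hN : t k = ∑ r, n r := by simp [t, hik]
  have htN : ∀ l ≤ k, t l ≤ ∑ r, n r := fun l hl =>
    hN ▸ ht.monotoneOn (Set.mem_Iic.2 hl) (Set.mem_Iic.2 le_rfl) hl
  have hiff := fun (f : {f : Fin ((∑ r, n r) + 1) → Fin q → ℕ // IsUPath (fun _ => 0) n f})
      (π : PolyPartition (∑ r, n r)) =>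
    map_range_mem_labeledFaces_iff (π := π) hti ht h0 hN (p := extF f.1)
      fun v hv => by simpa using f.2.sum_extF hv
  let g : (Σ f : {f : Fin ((∑ j', n j') + 1) → Fin q → ℕ // IsUPath (fun _ => 0) n f},
        {π : PolyPartition (∑ j', n j') //
          ((List.range (k + 1)).map i) ∈ labeledFaces π (extF f.1)}) →
      ((j : {j : ℕ // j ∈ (Finset.Icc 1 k).filter fun j => 2 ≤ dist (i (j - 1)) (i j)}) →
        ({f : Fin (dist (i (j.1 - 1)) (i j.1) + 1) → Fin q → ℕ //
            IsUPath (i (j.1 - 1)) (i j.1) f}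
          × PolyPartition (dist (i (j.1 - 1)) (i j.1)))) := fun x j =>
    (⟨fun w => extF x.1.1 (t (j.1 - 1) + w), by
        obtain ⟨j, hj⟩ := j
        obtain ⟨hj, -⟩ := Finset.mem_filter.1 hj
        obtain ⟨l, rfl⟩ := Nat.exists_eq_add_of_le' (Finset.mem_Icc.1 hj).1
        have hl : l + 1 ≤ k := (Finset.mem_Icc.1 hj).2
        have hx := ((hiff x.1 x.2.1).1 x.2.2).1
        have hdl := hd l hl
        have := x.1.2.restrict (s := t l) (m := d l) (by have := htN _ hl; omega)
        rwa [hdl, hx l (by omega), hx (l + 1) hl] at this⟩,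
      x.2.1.restrict (t (j.1 - 1)) _)
  have hmem : ∀ l, l + 1 ∈ ((Finset.Icc 1 k).filter fun j => 2 ≤ dist (i (j - 1)) (i j)) ↔
      l < k ∧ 2 ≤ d l := by
    intro l
    simp only [Finset.mem_filter, Finset.mem_Icc, Nat.add_sub_cancel, d]
    omega
  have hginj : Function.Injective g := by
    rintro ⟨f, π, hπ⟩ ⟨f', π', hπ'⟩ heq
    obtain ⟨hf, hs⟩ := (hiff f π).1 hπ
    obtain ⟨hf', hs'⟩ := (hiff f' π').1 hπ'
    have hblock := fun l hl => congrFun heq ⟨l + 1, (hmem l).2 hl⟩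
    have hff : f = f' := by
      refine Subtype.ext (funext fun v => ?_)
      rw [← extF_val f.1, ← extF_val f'.1]
      rcases (Nat.lt_succ_iff.1 v.2).lt_or_eq with hv | hv
      · obtain ⟨l, hl, h1, h2⟩ := exists_block h0 (hv.trans_eq hN.symm)
        have hdl := hd l hl
        by_cases h3 : 2 ≤ d l
        · have h4 := congrFun (congrArg Subtype.val (congrArg Prod.fst (hblock l ⟨hl, h3⟩)))
            ⟨v - t l, by change _ < d l + 1; omega⟩
          have h5 : t l + (v - t l) = v := by omega
          simpa only [g, Nat.add_sub_cancel, h5] using h4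
        · rw [show (v : ℕ) = t l by omega, hf l hl.le, hf' l hl.le]
      · rw [hv, f.2.extF_last, f'.2.extF_last]
    subst hff
    have hrestr : ∀ l < k, t l + 2 ≤ t (l + 1) →
        π.restrict (t l) (d l) = π'.restrict (t l) (d l) := fun l hl h2 =>
      congrArg Prod.snd (hblock l ⟨hl, by have := hd l hl; omega⟩)
    have hππ : π = π' := PolyPartition.ext ((hs.subset_of_restrict_eq hd hs' hrestr).antisymm
      (hs'.subset_of_restrict_eq hd hs fun l hl h2 => (hrestr l hl h2).symm))
    subst hππ
    rfl
  have hgsurj : Function.Surjective g := by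
    intro a
    let P : ℕ → ℕ → Fin q → ℕ := fun l m =>
      if h : l + 1 ∈ ((Finset.Icc 1 k).filter fun j => 2 ≤ dist (i (j - 1)) (i j)) then
        extF (a ⟨l + 1, h⟩).1.1 m else if m = 0 then i l else i (l + 1)
    let E : ∀ l, PolyPartition (d l) := fun l =>
      if h : l + 1 ∈ ((Finset.Icc 1 k).filter fun j => 2 ≤ dist (i (j - 1)) (i j)) then
        (a ⟨l + 1, h⟩).2 else default
    have hdpos : ∀ l < k, 0 < d l := fun l hl => by
      have := hd l hl
      have : t l < t (l + 1) := ht (Set.mem_Iic.2 (by omega)) (Set.mem_Iic.2 hl) (by omega)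
      omega
    have hP0 : ∀ l, P l 0 = i l := fun l => by
      by_cases h : l + 1 ∈ ((Finset.Icc 1 k).filter fun j => 2 ≤ dist (i (j - 1)) (i j))
      · simp only [P, dif_pos h]
        exact (a ⟨l + 1, h⟩).1.2.extF_zero
      · simp only [P, dif_neg h, if_true]
    have hPd : ∀ l < k, P l (d l) = i (l + 1) := fun l hl => by
      by_cases h : l + 1 ∈ ((Finset.Icc 1 k).filter fun j => 2 ≤ dist (i (j - 1)) (i j))
      · simp only [P, dif_pos h]
        exact (a ⟨l + 1, h⟩).1.2.extF_last
      · simp only [P, dif_neg h, if_neg (hdpos l hl).ne']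
    have hPstep : ∀ l < k, ∀ m < d l, ∃ r, P l (m + 1) = fun j => P l m j + unitv q r j := by
      intro l hl m hm
      by_cases h : l + 1 ∈ ((Finset.Icc 1 k).filter fun j => 2 ≤ dist (i (j - 1)) (i j))
      · simp only [P, dif_pos h]
        exact (a ⟨l + 1, h⟩).1.2.2.2 m hm
      · have h1 : d l = 1 := by
          have := hdpos l hl
          have := mt (hmem l).2 h
          omega
        obtain rfl : m = 0 := by omega
        rw [hP0, zero_add, ← h1, hPd l hl]
        exact exists_unit_step (hmono l (l + 1) (by omega) (by omega)).le h1
    obtain ⟨p, hp⟩ := exists_glued_path P k ht hd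
      fun l hl => by rw [hPd l (by omega), hP0]
    obtain ⟨π, hs, hπ⟩ := exists_glued_partition hk hd ht h0 hN E
    have hpt : ∀ l ≤ k, p (t l) = i l := by
      intro l hl
      rcases hl.lt_or_eq with hl | rfl
      · have := hp l hl 0 (by have := hd l hl; omega)
        rwa [add_zero, hP0] at this
      · obtain ⟨l, rfl⟩ := Nat.exists_eq_add_of_le' (show 1 ≤ l by omega)
        have hdl := hd l (by omega)
        rw [← hdl, hp l (by omega) _ hdl.le, hPd l (by omega)]
    have hpath : IsUPath (fun _ => 0) n fun w : Fin ((∑ r, n r) + 1) => p w := by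
      refine isUPath_iff.2 ⟨?_, ?_, fun v hv => ?_⟩
      · rw [← hi0, ← hpt 0 (by omega), h0]
      · rw [← hN, hpt k le_rfl, hik]
      · obtain ⟨l, hl, h1, h2⟩ := exists_block h0 (hv.trans_eq hN.symm)
        have hdl := hd l hl
        obtain ⟨m, rfl⟩ := Nat.exists_eq_add_of_le h1
        rw [add_assoc, hp l hl _ (by omega), hp l hl _ (by omega)]
        exact hPstep l hl m (by omega)
    refine ⟨⟨⟨_, hpath⟩, π, (hiff ⟨_, hpath⟩ π).2 ⟨fun l hl => ?_, hs⟩⟩, ?_⟩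
    · rw [extF_of_le p (htN l hl), hpt l hl]
    · funext ⟨j, hj⟩
      obtain ⟨l, rfl⟩ := Nat.exists_eq_add_of_le'
        (Finset.mem_Icc.1 (Finset.mem_filter.1 hj).1).1
      obtain ⟨hl, h2⟩ := (hmem l).1 hj
      have hdl := hd l hl
      refine Prod.ext (Subtype.ext (funext fun w => ?_)) ?_
      · have hw : (w : ℕ) ≤ d l := Nat.lt_succ_iff.1 w.2
        have := htN (l + 1) hl
        change extF (fun w : Fin ((∑ r, n r) + 1) => p w) (t l + w) = _
        rw [extF_of_le p (by omega), hp l hl w (by omega),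
          ← extF_val (a ⟨l + 1, hj⟩).1.1]
        simp only [P, dif_pos hj]
      · refine (hπ l hl (by omega)).trans ?_
        simp only [E, dif_pos hj]
  refine ⟨(Equiv.ofBijective g ⟨hginj, hgsurj⟩).symm, fun a => ?_⟩
  obtain ⟨x, rfl⟩ := hgsurj a
  rw [show (Equiv.ofBijective g ⟨hginj, hgsurj⟩).symm (g x) = x from
    Equiv.ofBijective_symm_apply_apply g _ x]
  obtain ⟨f, π, hπ⟩ := x
  obtain ⟨hf, hs⟩ := (hiff f π).1 hπ
  have htop : (List.range (k + 1)).map i =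
      ((faceOf π.diags 0 (∑ r, n r)).sort (· ≤ ·)).map (extF f.1) := by
    rw [(π.faceOf_top_iff ht h0 hN).2 hs, sort_image_range_succ ht, List.map_map]
    exact List.map_congr_left fun l hl => (hf l (by have := List.mem_range.1 hl; omega)).symm
  have hface : ∀ l (hl : l + 1 ∈ _) L,
      L ∈ labeledFaces (g ⟨f, π, hπ⟩ ⟨l + 1, hl⟩).2 (extF (g ⟨f, π, hπ⟩ ⟨l + 1, hl⟩).1.1) ↔ _ :=
    fun l hl L => mem_labeledFaces_restrict (π := π) (p := extF f.1) (s := t l)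
      (fun v hv => extF_of_le (fun w => extF f.1 (t l + w)) hv)
  ext L
  rw [mem_labeledFaces_of_splitsAt hd hs, Finset.mem_insert, Finset.mem_biUnion]
  refine or_congr ⟨fun h => h.trans htop.symm, fun h => h.trans htop⟩ ⟨?_, ?_⟩
  · rintro ⟨l, hl, h2, h⟩
    exact ⟨⟨l + 1, (hmem l).2 ⟨hl, h2⟩⟩, Finset.mem_attach _ _, (hface l _ L).2 h⟩
  · rintro ⟨⟨j, hj⟩, -, h⟩
    obtain ⟨l, rfl⟩ := Nat.exists_eq_add_of_le' (Finset.mem_Icc.1 (Finset.mem_filter.1 hj).1).1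
    obtain ⟨hl, h2⟩ := (hmem l).1 hj
    exact ⟨l, hl, h2, (hface l hj L).1 h⟩

end ImplicitDD
end
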